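/- arXiv:1812.11618 — 13 statements merged into one kernel-verified Lean document; each statement's English description precedes it below -/
import Mathlib

section
/- Let A be a complex Banach algebra with identity and let a ∈ A. Then a has a gs-Drazin inverse if and only if (1) a has a g-Drazin inverse, and (2) a − a² ∈ A^{qnil}. -/
/-- `a` is quasinilpotent: `1 + a*x` is invertible for every `x` commuting with `a`. -/
def Quasinilpotent {A : Type*} [Ring A] (a : A) : Prop :=
  ∀ x : A, x * a = a * x → IsUnit (1 + a * x)

/-- `b` is a g-Drazin inverse of `a`. -/
def IsGDrazinInv {A : Type*} [Ring A] (a b : A) : Prop :=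
  b = b * a * b ∧ a * b = b * a ∧ Quasinilpotent (a - a ^ 2 * b)

/-- `b` is a gs-Drazin inverse of `a`. -/
def IsGSDrazinInv {A : Type*} [Ring A] (a b : A) : Prop :=
  b = b * a * b ∧ a * b = b * a ∧ Quasinilpotent (a - a * b)

/-- `b` is a generalized Hirano inverse of `a`. -/
def IsGenHiranoInv {A : Type*} [Ring A] (a b : A) : Prop :=
  b = b * a * b ∧ a * b = b * a ∧ Quasinilpotent (a ^ 2 - a * b)


def PowSmall {A : Type*} [NormedRing A] (a : A) : Prop :=
  ∀ ε : ℝ, 0 < ε → ∃ C : ℝ, 0 ≤ C ∧ ∀ n : ℕ, ‖a ^ n‖ ≤ C * ε ^ n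

theorem PowSmall.mul {A : Type*} [NormedRing A] {q c : A} (h : PowSmall q) (hc : Commute q c) :
    PowSmall (q * c) := by
  intro ε hε
  have hp : 0 < ‖c‖ + 1 := by positivity
  obtain ⟨C, hC0, hC⟩ := h (ε / (‖c‖ + 1)) (by positivity)
  have hcn : ∀ n : ℕ, ‖c ^ n‖ ≤ (‖(1 : A)‖ + 1) * (‖c‖ + 1) ^ n := by
    intro n
    rcases Nat.eq_zero_or_pos n with rfl | hn
    · simp
    · calc ‖c ^ n‖ ≤ ‖c‖ ^ n := norm_pow_le' c hn
        _ ≤ (‖c‖ + 1) ^ n := by gcongr; linarith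
        _ ≤ _ := le_mul_of_one_le_left (by positivity) (by linarith [norm_nonneg (1 : A)])
  refine ⟨C * (‖(1 : A)‖ + 1), by positivity, fun n => ?_⟩
  rw [hc.mul_pow]
  calc ‖q ^ n * c ^ n‖ ≤ ‖q ^ n‖ * ‖c ^ n‖ := norm_mul_le _ _
    _ ≤ (C * (ε / (‖c‖ + 1)) ^ n) * ((‖(1 : A)‖ + 1) * (‖c‖ + 1) ^ n) := by
        gcongr
        · exact hC n
        · exact hcn n
    _ = _ := by
        rw [div_pow]; field_simp

theorem PowSmall.add {A : Type*} [NormedRing A] {p q : A} (hp : PowSmall p) (hq : PowSmall q)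
    (hc : Commute p q) : PowSmall (p + q) := by
  intro ε hε
  obtain ⟨C, hC0, hC⟩ := hp (ε / 2) (by positivity)
  obtain ⟨D, hD0, hD⟩ := hq (ε / 2) (by positivity)
  refine ⟨C * D, by positivity, fun n => ?_⟩
  rw [hc.add_pow]
  have e : C * D * ε ^ n = ∑ m ∈ Finset.range (n + 1),
      (C * (ε / 2) ^ m) * (D * (ε / 2) ^ (n - m)) * (n.choose m : ℝ) := by
    have : ε = ε / 2 + ε / 2 := by ring
    conv_lhs => rw [this, add_pow, Finset.mul_sum]
    refine Finset.sum_congr rfl fun m _ => by ring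
  rw [e]
  refine (norm_sum_le _ _).trans (Finset.sum_le_sum fun m _ => ?_)
  rw [← nsmul_eq_mul']
  refine (norm_nsmul_le).trans ?_
  rw [mul_comm]
  gcongr
  refine (norm_mul_le _ _).trans ?_
  gcongr
  · exact hC m
  · exact hD _

theorem PowSmall.neg {A : Type*} [NormedRing A] {q : A} (h : PowSmall q) : PowSmall (-q) := by
  have := h.mul (Commute.neg_one_right q)
  simpa using this

theorem PowSmall.isUnit {A : Type*} [NormedRing A] [CompleteSpace A] {q : A} (h : PowSmall q) :
    IsUnit (1 - q) := by
  obtain ⟨C, hC0, hC⟩ := h (1 / 2) (by positivity)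
  have ht : Filter.Tendsto (fun n : ℕ => C * (1 / 2 : ℝ) ^ n) Filter.atTop (nhds (C * 0)) :=
    (tendsto_pow_atTop_nhds_zero_of_lt_one (by norm_num) (by norm_num)).const_mul C
  rw [mul_zero] at ht
  obtain ⟨n, hn⟩ := (ht.eventually (gt_mem_nhds one_pos)).exists
  have hu : IsUnit (1 - q ^ n) := isUnit_one_sub_of_norm_lt_one ((hC n).trans_lt hn)
  rw [← mul_neg_geom_sum q n] at hu
  have hcomm : Commute (1 - q) (∑ i ∈ Finset.range n, q ^ i) := by
    unfold Commute SemiconjBy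
    rw [mul_neg_geom_sum, geom_sum_mul_neg]
  exact (hcomm.isUnit_mul_iff.mp hu).1

theorem PowSmall.quasi {A : Type*} [NormedRing A] [CompleteSpace A] {q : A} (h : PowSmall q) :
    Quasinilpotent q := by
  intro x hx
  have := (h.mul (c := x) hx.symm).neg.isUnit
  simpa using this

theorem Quasinilpotent.powSmall {A : Type*} [NormedRing A] [NormedAlgebra ℂ A] [CompleteSpace A]
    {q : A} (h : Quasinilpotent q) : PowSmall q := by
  have hs : spectralRadius ℂ q = 0 := by
    unfold spectralRadius
    simp only [ENNReal.iSup_eq_zero]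
    intro k hk
    by_contra hk0
    have hk0' : k ≠ 0 := by rintro rfl; simp at hk0
    apply hk
    have h1 := h (-(algebraMap ℂ A k⁻¹)) (by
      rw [neg_mul, mul_neg, Algebra.commutes])
    have h2 : IsUnit (algebraMap ℂ A k) := (IsUnit.mk0 k hk0').map _
    have h3 := h2.mul h1
    have e : algebraMap ℂ A k * (1 + q * -(algebraMap ℂ A k⁻¹)) = algebraMap ℂ A k - q := by
      rw [mul_neg, ← Algebra.commutes, mul_add, mul_neg, ← mul_assoc, ← map_mul,
        mul_inv_cancel₀ hk0']
      simp [sub_eq_add_neg]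
    rwa [e] at h3
  intro ε hε
  have ht := spectrum.pow_norm_pow_one_div_tendsto_nhds_spectralRadius q
  rw [hs] at ht
  have hev := ht.eventually (gt_mem_nhds (ENNReal.ofReal_pos.mpr hε))
  have hev2 : ∀ᶠ n : ℕ in Filter.atTop, ‖q ^ n‖ / ε ^ n ≤ 1 := by
    filter_upwards [hev, Filter.eventually_gt_atTop 0] with n hn hn0
    rw [ENNReal.ofReal_lt_ofReal_iff hε] at hn
    rw [div_le_one (by positivity)]
    have := pow_le_pow_left₀ (by positivity) hn.le n
    rwa [one_div, Real.rpow_inv_natCast_pow (norm_nonneg _) hn0.ne'] at this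
  have hb : BddAbove (Set.range fun n : ℕ => ‖q ^ n‖ / ε ^ n) :=
    Filter.IsBoundedUnder.bddAbove_range ⟨1, by simpa using hev2⟩
  obtain ⟨C, hC⟩ := hb
  have hC' : ∀ n : ℕ, ‖q ^ n‖ / ε ^ n ≤ C := fun n => hC ⟨n, rfl⟩
  refine ⟨C, le_trans (by positivity) (hC' 0), fun n => ?_⟩
  exact (div_le_iff₀ (by positivity)).mp (hC' n)

theorem stmt0 {A : Type*} [NormedRing A] [NormedAlgebra ℂ A] [CompleteSpace A] (a : A) :
    (∃ b, IsGSDrazinInv a b) ↔ (∃ b, IsGDrazinInv a b) ∧ Quasinilpotent (a - a ^ 2) := by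
  have key : ∀ b : A, b = b * a * b → a * b = b * a → a * b * (a * b) = a * b := by
    intro b h1 h2
    calc a * b * (a * b) = a * (b * a * b) := by noncomm_ring
      _ = a * b := by rw [← h1]
  constructor
  · rintro ⟨b, h1, h2, h3⟩
    have he := key b h1 h2
    have hab : Commute a b := h2
    have hq := h3.powSmall
    have hae : Commute a (a * b) := (Commute.refl a).mul_right hab
    have hqe : Commute (a - a * b) (a * b) := hae.sub_left (Commute.refl _)
    have hqa : Commute (a - a * b) a := (Commute.refl a).sub_left hae.symm
    refine ⟨⟨b, h1, h2, ?_⟩, ?_⟩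
    · have := (hq.mul ((Commute.one_right _).sub_right hqe)).quasi
      convert this using 1
      have e2 : a * (a * b) = a * b * a := hae
      have : a ^ 2 * b = a * (a * b) := by noncomm_ring
      rw [this, sub_mul, mul_sub, mul_sub, he]
      simp
    · have := (hq.mul (((Commute.one_right _).sub_right hqe).sub_right hqa)).quasi
      convert this using 1
      have e2 : a * (a * b) = a * b * a := hae
      simp only [sub_mul, mul_sub, he, e2, mul_one, sq]
      abel
  · rintro ⟨⟨b, h1, h2, h3⟩, h4⟩
    have he := key b h1 h2
    have hab : Commute a b := h2
    refine ⟨b, h1, h2, ?_⟩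
    have c1 : Commute (a - a ^ 2) b := hab.sub_left (hab.pow_left 2)
    have ca : Commute a (a - a ^ 2 * b) :=
      (Commute.refl a).sub_right (((Commute.refl a).pow_right 2).mul_right hab)
    have cb : Commute b (a - a ^ 2 * b) :=
      hab.symm.sub_right ((hab.symm.pow_right 2).mul_right (Commute.refl b))
    have c2 : Commute (-((a - a ^ 2) * b)) (a - a ^ 2 * b) :=
      ((ca.sub_left (ca.pow_left 2)).mul_left cb).neg_left
    have := ((h4.powSmall.mul c1).neg.add h3.powSmall c2).quasi
    convert this using 1
    noncomm_ring
end

section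
/- Let A be a complex Banach algebra with identity and let a ∈ A. The following are equivalent: (1) a has a generalized Hirano inverse; (2) a² has a gs-Drazin inverse; (3) there exists b ∈ comm(a) such that b = (ab)² and a² − a²b ∈ A^{qnil}. -/
lemma qnil_pow_small {A : Type*} [NormedRing A] [NormedAlgebra ℂ A] [CompleteSpace A] (q : A)
    (hq : Quasinilpotent q) (ε : ℝ) (hε : 0 < ε) : ∃ n : ℕ, 0 < n ∧ ‖q ^ n‖ ≤ ε ^ n := by
  have hr : spectralRadius ℂ q = 0 := by
    unfold spectralRadius
    simp only [ENNReal.iSup_eq_zero]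
    intro k hk
    by_contra hne
    have hk0 : k ≠ 0 := by
      rintro rfl
      simp at hne
    apply hk
    have h1 := hq (algebraMap ℂ A (-k⁻¹)) (Algebra.commutes _ _)
    have h2 : IsUnit (algebraMap ℂ A k) := (IsUnit.mk0 k hk0).map _
    have h3 := h2.mul h1
    have h4 : algebraMap ℂ A k * (1 + q * algebraMap ℂ A (-k⁻¹)) = algebraMap ℂ A k - q := by
      rw [← Algebra.commutes (-k⁻¹) q, mul_add, ← mul_assoc, ← map_mul]
      simp [hk0, sub_eq_add_neg]
    rw [h4] at h3
    exact h3
  have ht := spectrum.pow_nnnorm_pow_one_div_tendsto_nhds_spectralRadius q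
  rw [hr] at ht
  have hev := ht.eventually_lt_const (u := ENNReal.ofReal ε) (by simpa using hε)
  obtain ⟨n, hn, hn0⟩ := (hev.and (Filter.eventually_gt_atTop 0)).exists
  refine ⟨n, hn0, ?_⟩
  have hn0' : (n : ℝ) ≠ 0 := by exact_mod_cast hn0.ne'
  have h5 : (‖q ^ n‖₊ : ENNReal) ≤ ENNReal.ofReal ε ^ n := by
    have h6 := pow_le_pow_left' hn.le n
    rwa [← ENNReal.rpow_natCast, ← ENNReal.rpow_mul, one_div_mul_cancel hn0',
      ENNReal.rpow_one] at h6
  rw [← ENNReal.ofReal_pow hε.le] at h5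
  have h7 := ENNReal.toReal_mono ENNReal.ofReal_ne_top h5
  rwa [ENNReal.toReal_ofReal (by positivity)] at h7

lemma norm_aux {A : Type*} [NormedRing A] [NormedAlgebra ℂ A] [CompleteSpace A] (q b x : A)
    (hq : Quasinilpotent q) (h : ∀ n : ℕ, 0 < n → ‖x‖ ≤ ‖b‖ ^ n * ‖x‖ * ‖q ^ n‖) : x = 0 := by
  obtain ⟨n, hn, hle⟩ := qnil_pow_small q hq (1 / (2 * (‖b‖ + 1))) (by positivity)
  have h1 := h n hn
  have h2 : ‖x‖ ≤ ‖x‖ * (1 / 2) := by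
    calc ‖x‖ ≤ ‖b‖ ^ n * ‖x‖ * ‖q ^ n‖ := h1
      _ ≤ ‖b‖ ^ n * ‖x‖ * (1 / (2 * (‖b‖ + 1))) ^ n := by gcongr
      _ = ‖x‖ * (‖b‖ * (1 / (2 * (‖b‖ + 1)))) ^ n := by rw [mul_pow]; ring
      _ ≤ ‖x‖ * (1 / 2) ^ n := by
        gcongr
        rw [mul_one_div, div_le_div_iff₀ (by positivity) (by positivity)]
        linarith
      _ ≤ ‖x‖ * (1 / 2) := by
        gcongr
        exact pow_le_of_le_one (by norm_num) (by norm_num) hn.ne'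
  have h3 : ‖x‖ = 0 := by linarith [norm_nonneg x]
  exact norm_eq_zero.mp h3

lemma aux_right {A : Type*} [NormedRing A] [NormedAlgebra ℂ A] [CompleteSpace A] (q b x : A)
    (hq : Quasinilpotent q) (h : x = b * x * q) : x = 0 := by
  have hp : ∀ n : ℕ, x = b ^ n * x * q ^ n := by
    intro n
    induction n with
    | zero => simp
    | succ k ih =>
      calc x = b ^ k * x * q ^ k := ih
        _ = b ^ k * (b * x * q) * q ^ k := by rw [← h]
        _ = b ^ (k + 1) * x * q ^ (k + 1) := by rw [pow_succ, pow_succ']; simp only [mul_assoc]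
  refine norm_aux q b x hq fun n hn => ?_
  calc ‖x‖ = ‖b ^ n * x * q ^ n‖ := by rw [← hp n]
    _ ≤ ‖b ^ n‖ * ‖x‖ * ‖q ^ n‖ := norm_mul₃_le
    _ ≤ ‖b‖ ^ n * ‖x‖ * ‖q ^ n‖ := by gcongr; exact norm_pow_le' b hn

lemma aux_left {A : Type*} [NormedRing A] [NormedAlgebra ℂ A] [CompleteSpace A] (q b x : A)
    (hq : Quasinilpotent q) (h : x = q * x * b) : x = 0 := by
  have hp : ∀ n : ℕ, x = q ^ n * x * b ^ n := by
    intro n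
    induction n with
    | zero => simp
    | succ k ih =>
      calc x = q ^ k * x * b ^ k := ih
        _ = q ^ k * (q * x * b) * b ^ k := by rw [← h]
        _ = q ^ (k + 1) * x * b ^ (k + 1) := by rw [pow_succ, pow_succ']; simp only [mul_assoc]
  refine norm_aux q b x hq fun n hn => ?_
  calc ‖x‖ = ‖q ^ n * x * b ^ n‖ := by rw [← hp n]
    _ ≤ ‖q ^ n‖ * ‖x‖ * ‖b ^ n‖ := norm_mul₃_le
    _ ≤ ‖q ^ n‖ * ‖x‖ * ‖b‖ ^ n := by gcongr; exact norm_pow_le' b hn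
    _ = ‖b‖ ^ n * ‖x‖ * ‖q ^ n‖ := by ring

/-- A gs-Drazin inverse of `d` commutes with everything commuting with `d`. -/
lemma gs_comm {A : Type*} [NormedRing A] [NormedAlgebra ℂ A] [CompleteSpace A] (d b a : A)
    (hb : IsGSDrazinInv d b) (had : a * d = d * a) : b * a = a * b := by
  obtain ⟨h1, h2, h3⟩ := hb
  obtain ⟨e, he⟩ : ∃ e, e = d * b := ⟨_, rfl⟩
  have hbe : b * e = b := by rw [he, ← mul_assoc, ← h1]
  have heb : e * b = b := by rw [he, h2, ← h1]
  have hee : e * e = e := by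
    nth_rewrite 1 [he]
    rw [mul_assoc, hbe, he]
  have hed : e * d = d * e := by rw [he, mul_assoc, ← h2]
  have hbd : b * d = e := by rw [he, h2]
  rw [← he] at h3
  have k1 : (1 - e) * (d - e) = (1 - e) * d := by
    rw [mul_sub, sub_mul 1 e e, hee]; simp
  have k2 : (d - e) * (1 - e) = d * (1 - e) := by
    rw [sub_mul, mul_sub e 1 e, hee]; simp
  have k3 : (1 - e) * d = d * (1 - e) := by rw [sub_mul, mul_sub, hed]; simp
  have k4 : (1 - e) * (1 - e) = 1 - e := by rw [sub_mul, mul_sub e, hee]; simp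
  have x0 : e * a * (1 - e) = 0 := by
    apply aux_right (d - e) b _ h3
    symm
    calc b * (e * a * (1 - e)) * (d - e) = (b * e) * a * ((1 - e) * (d - e)) := by
          simp only [mul_assoc]
      _ = b * (a * d) * (1 - e) := by rw [k1, k3, hbe]; simp only [mul_assoc]
      _ = (b * d) * a * (1 - e) := by rw [had]; simp only [mul_assoc]
      _ = e * a * (1 - e) := by rw [hbd]
  have y0 : (1 - e) * a * e = 0 := by
    apply aux_left (d - e) b _ h3
    symm
    calc (d - e) * ((1 - e) * a * e) * b = ((d - e) * (1 - e)) * a * (e * b) := by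
          simp only [mul_assoc]
      _ = (1 - e) * (d * a) * b := by rw [k2, ← k3, heb]; simp only [mul_assoc]
      _ = (1 - e) * a * (d * b) := by rw [← had]; simp only [mul_assoc]
      _ = (1 - e) * a * e := by rw [he]
  have hea : e * a = a * e := by
    rw [mul_sub, mul_one, sub_eq_zero] at x0
    rw [sub_mul, sub_mul, one_mul, sub_eq_zero] at y0
    rw [x0, y0]
  calc b * a = b * (e * a) := by rw [← mul_assoc, hbe]
    _ = b * (a * d) * b := by rw [hea, he]; simp only [mul_assoc]
    _ = (b * d) * a * b := by rw [had]; simp only [mul_assoc]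
    _ = a * (e * b) := by rw [hbd, hea]; simp only [mul_assoc]
    _ = a * b := by rw [heb]

theorem stmt1 {A : Type*} [NormedRing A] [NormedAlgebra ℂ A] [CompleteSpace A] (a : A) :
    ((∃ b, IsGenHiranoInv a b) ↔ (∃ b, IsGSDrazinInv (a ^ 2) b)) ∧
    ((∃ b, IsGenHiranoInv a b) ↔
      (∃ b, b * a = a * b ∧ b = (a * b) ^ 2 ∧ Quasinilpotent (a ^ 2 - a ^ 2 * b))) := by
  have h13 : (∃ b, IsGenHiranoInv a b) →
      (∃ b, b * a = a * b ∧ b = (a * b) ^ 2 ∧ Quasinilpotent (a ^ 2 - a ^ 2 * b)) := by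
    rintro ⟨b, h1, h2, h3⟩
    have hab : Commute a b := h2
    have e1 : (a * b) * (a * b) = a * b := by
      rw [mul_assoc, ← mul_assoc b, ← h1]
    have e2 : a ^ 2 * b ^ 2 = a * b := by
      rw [← hab.mul_pow, sq, e1]
    have e3 : a * b * b = b := by rw [h2, ← h1]
    refine ⟨b ^ 2, (hab.pow_right 2).eq.symm, ?_, ?_⟩
    · have e4 : a * b ^ 2 = b := by rw [sq, ← mul_assoc, e3]
      rw [e4]
    · rwa [e2]
  have h32 : (∃ b, b * a = a * b ∧ b = (a * b) ^ 2 ∧ Quasinilpotent (a ^ 2 - a ^ 2 * b)) →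
      (∃ b, IsGSDrazinInv (a ^ 2) b) := by
    rintro ⟨b, h1, h2, h3⟩
    have hab : Commute a b := h1.symm
    refine ⟨b, ?_, (hab.pow_left 2).eq, h3⟩
    rw [← (hab.pow_left 2).eq, mul_assoc, ← sq, ← hab.mul_pow, ← h2]
  have h21 : (∃ b, IsGSDrazinInv (a ^ 2) b) → (∃ b, IsGenHiranoInv a b) := by
    rintro ⟨b, hb⟩
    have hba : b * a = a * b := gs_comm (a ^ 2) b a hb (by rw [← pow_succ, ← pow_succ'])
    obtain ⟨h1, h2, h3⟩ := hb
    refine ⟨a * b, ?_, ?_, ?_⟩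
    · calc a * b = a * (b * a ^ 2 * b) := by rw [← h1]
        _ = a * b * a * (a * b) := by rw [sq]; simp only [mul_assoc]
    · rw [mul_assoc, hba]
    · rwa [← mul_assoc, ← sq]
  exact ⟨⟨fun h => h32 (h13 h), h21⟩, ⟨h13, fun h => h21 (h32 h)⟩⟩
end

section
/- Let A be a complex Banach algebra with identity and let a ∈ A. Then a has a generalized Hirano inverse if and only if (1) a has a g-Drazin inverse, and (2) a − a³ ∈ A^{qnil}. -/
section helpers

variable {A : Type*} [NormedRing A] [NormedAlgebra ℂ A] [CompleteSpace A]

open Filter Topology ENNReal in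
theorem qn_of_scalar (c : A) (h : ∀ z : ℂ, IsUnit (1 + z • c)) : Quasinilpotent c := by
  have hr : spectralRadius ℂ c = 0 := by
    unfold spectralRadius
    refine le_antisymm (iSup₂_le fun k hk => ?_) bot_le
    by_cases hk0 : k = 0
    · simp [hk0]
    · exfalso
      apply hk
      have h1 := h (-k⁻¹)
      have h2 : algebraMap ℂ A k - c = algebraMap ℂ A k * (1 + (-k⁻¹) • c) := by
        rw [Algebra.algebraMap_eq_smul_one, smul_mul_assoc, one_mul, smul_add, smul_smul]
        simp [hk0, sub_eq_add_neg]
      show IsUnit _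
      rw [h2]
      exact ((IsUnit.mk0 k hk0).map (algebraMap ℂ A)).mul h1
  have hg := spectrum.pow_nnnorm_pow_one_div_tendsto_nhds_spectralRadius c
  rw [hr] at hg
  intro x hx
  have hcx : Commute c x := hx.symm
  obtain ⟨n, hn0, hn⟩ : ∃ n : ℕ, n ≠ 0 ∧ ‖(-(c * x)) ^ n‖ < 1 := by
    have hε : (0 : ℝ≥0∞) < ((‖x‖₊ + 1 : NNReal) : ℝ≥0∞)⁻¹ := by
      simp only [ENNReal.inv_pos]; exact ENNReal.coe_ne_top
    obtain ⟨n, hn, hn0⟩ := ((hg.eventually (gt_mem_nhds hε)).and (eventually_gt_atTop 0)).exists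
    refine ⟨n, hn0.ne', ?_⟩
    have hnR : (0 : ℝ) < n := by exact_mod_cast hn0
    have h1 : (‖c ^ n‖₊ : ℝ≥0∞) < (((‖x‖₊ + 1 : NNReal) : ℝ≥0∞)⁻¹) ^ (n : ℝ) := by
      have := ENNReal.rpow_lt_rpow hn hnR
      rwa [← ENNReal.rpow_mul, one_div, inv_mul_cancel₀ hnR.ne', ENNReal.rpow_one] at this
    rw [ENNReal.rpow_natCast, ← ENNReal.coe_inv (by positivity), ← ENNReal.coe_pow,
      ENNReal.coe_lt_coe] at h1
    have h2 : ‖c ^ n‖ < ((‖x‖ + 1)⁻¹) ^ n := by exact_mod_cast h1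
    have h3 : ‖(-(c * x)) ^ n‖ = ‖c ^ n * x ^ n‖ := by
      rw [← hcx.mul_pow]
      rw [neg_pow]
      rcases neg_one_pow_eq_or A n with h | h <;> simp [h]
    have hx1 : 0 < ‖x‖ + 1 := by positivity
    calc _ = _ := h3
      _ ≤ ‖c ^ n‖ * ‖x ^ n‖ := norm_mul_le _ _
      _ ≤ ‖c ^ n‖ * (‖x‖ + 1) ^ n := by
          gcongr
          exact (norm_pow_le' x hn0).trans (by gcongr; linarith)
      _ < ((‖x‖ + 1)⁻¹) ^ n * (‖x‖ + 1) ^ n := by gcongr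
      _ = 1 := by rw [← mul_pow, inv_mul_cancel₀ hx1.ne', one_pow]
  have hu : IsUnit (1 - (-(c * x)) ^ n) := isUnit_one_sub_of_norm_lt_one hn
  rw [← mul_neg_geom_sum] at hu
  have hcm : Commute (1 - -(c * x)) (∑ i ∈ Finset.range n, (-(c * x)) ^ i) := by
    rw [commute_iff_eq, mul_neg_geom_sum, geom_sum_mul_neg]
  have := (hcm.isUnit_mul_iff.1 hu).1
  rwa [sub_neg_eq_add] at this

theorem qn_scalar {c : A} (h : Quasinilpotent c) (z : ℂ) : IsUnit (1 + z • c) := by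
  have := h (algebraMap ℂ A z) (Algebra.commutes z c)
  rwa [← Algebra.commutes, ← Algebra.smul_def] at this

theorem qn_mul {p x : A} (h : Quasinilpotent p) (hx : Commute p x) : Quasinilpotent (p * x) := by
  refine qn_of_scalar _ fun z => ?_
  have := h (z • x) (hx.smul_right z).symm
  rwa [mul_smul_comm] at this

theorem qn_add {p q : A} (hp : Quasinilpotent p) (hq : Quasinilpotent q) (hc : Commute p q) :
    Quasinilpotent (p + q) := by
  refine qn_of_scalar _ fun z => ?_
  obtain ⟨u, hu⟩ := qn_scalar hp z
  have hcu : Commute q (u : A) := by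
    rw [hu]; exact (Commute.one_right q).add_right (hc.symm.smul_right z)
  have h2 := hq (z • (↑u⁻¹ : A)) ((hcu.units_inv_right).smul_right z).symm
  have h3 : 1 + z • (p + q) = u * (1 + q * (z • (↑u⁻¹ : A))) := by
    rw [mul_add, mul_one, mul_smul_comm, mul_smul_comm, ← mul_assoc, ← hcu.eq, mul_assoc,
      Units.mul_inv, mul_one, hu, smul_add, add_assoc]
  rw [h3]
  exact u.isUnit.mul h2

theorem qn_of_sq {p : A} (h : Quasinilpotent (p * p)) : Quasinilpotent p := by
  refine qn_of_scalar _ fun z => ?_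
  have h1 := qn_scalar h (-(z * z))
  have h2 : 1 + (-(z * z)) • (p * p) = (1 + z • p) * (1 - z • p) := by
    rw [add_mul, mul_sub, mul_sub, smul_mul_smul_comm, neg_smul]; simp; abel
  have hcm : Commute (1 + z • p) (1 - z • p) := by
    apply Commute.add_left (Commute.one_left _)
    exact (Commute.one_right _).sub_right (Commute.refl _)
  rw [h2] at h1
  exact (hcm.isUnit_mul_iff.1 h1).1

end helpers

theorem stmt2 {A : Type*} [NormedRing A] [NormedAlgebra ℂ A] [CompleteSpace A] (a : A) :
    (∃ b, IsGenHiranoInv a b) ↔ (∃ b, IsGDrazinInv a b) ∧ Quasinilpotent (a - a ^ 3) := by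
  constructor
  · rintro ⟨b, h1, h2, hw⟩
    have hab : Commute a b := h2
    have r1 : a * b = b * a := h2
    have r2 : ∀ x, a * (b * x) = b * (a * x) := fun x => by rw [← mul_assoc, h2, mul_assoc]
    have r3 : b * (b * a) = b := by rw [← h2, ← mul_assoc]; exact h1.symm
    have r4 : ∀ x, b * (b * (a * x)) = b * x := fun x => by
      rw [← mul_assoc b a x, ← mul_assoc, r3]
    have haw : Commute a (a ^ 2 - a * b) :=
      ((Commute.refl a).pow_right 2).sub_right ((Commute.refl a).mul_right hab)
    have hbw : Commute b (a ^ 2 - a * b) :=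
      (hab.symm.pow_right 2).sub_right (hab.symm.mul_right (Commute.refl b))
    have hp : Quasinilpotent (a - a ^ 2 * b) := by
      apply qn_of_sq
      have e : (a - a ^ 2 * b) * (a - a ^ 2 * b) = (a ^ 2 - a * b) * (1 - a * b) := by
        simp only [pow_succ, pow_zero, one_mul, mul_sub, sub_mul, mul_one, mul_neg, mul_assoc, r1, r2, r3, r4]
        abel
      rw [e]
      exact qn_mul hw ((Commute.one_right _).sub_right (haw.symm.mul_right hbw.symm))
    refine ⟨⟨b, h1, h2, hp⟩, ?_⟩
    have e : a - a ^ 3 = (a - a ^ 2 * b) + (a ^ 2 - a * b) * (-a) := by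
      simp only [pow_succ, pow_zero, one_mul, mul_sub, sub_mul, mul_one, mul_neg, mul_assoc, r1, r2, r3, r4]
      abel
    rw [e]
    refine qn_add hp (qn_mul hw haw.symm.neg_right) ?_
    have haP : Commute (a - a ^ 2 * b) a :=
      ((Commute.refl a).sub_right (((Commute.refl a).pow_right 2).mul_right hab)).symm
    have hbP : Commute (a - a ^ 2 * b) b :=
      (hab.symm.sub_right ((hab.symm.pow_right 2).mul_right (Commute.refl b))).symm
    exact ((haP.pow_right 2).sub_right (haP.mul_right hbP)).mul_right haP.neg_right
  · rintro ⟨⟨b, h1, h2, hp⟩, hq⟩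
    refine ⟨b, h1, h2, ?_⟩
    have hab : Commute a b := h2
    have r1 : a * b = b * a := h2
    have r2 : ∀ x, a * (b * x) = b * (a * x) := fun x => by rw [← mul_assoc, h2, mul_assoc]
    have r3 : b * (b * a) = b := by rw [← h2, ← mul_assoc]; exact h1.symm
    have r4 : ∀ x, b * (b * (a * x)) = b * x := fun x => by
      rw [← mul_assoc b a x, ← mul_assoc, r3]
    have haP : Commute (a - a ^ 2 * b) a :=
      ((Commute.refl a).sub_right (((Commute.refl a).pow_right 2).mul_right hab)).symm
    have hbP : Commute (a - a ^ 2 * b) b :=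
      (hab.symm.sub_right ((hab.symm.pow_right 2).mul_right (Commute.refl b))).symm
    have hbq : Commute (a - a ^ 3) b := hab.sub_left (hab.pow_left 3)
    have e : a ^ 2 - a * b = (a - a ^ 2 * b) * a + (a - a ^ 3) * (-b) := by
      simp only [pow_succ, pow_zero, one_mul, mul_sub, sub_mul, mul_one, mul_neg, mul_assoc, r1, r2, r3, r4]
      abel
    rw [e]
    refine qn_add (qn_mul hp haP) (qn_mul hq hbq.neg_right) ?_
    exact ((haP.sub_right (haP.pow_right 3)).mul_right hbP.neg_right).mul_left
      (((Commute.refl a).sub_right ((Commute.refl a).pow_right 3)).mul_right hab.neg_right)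
end

section
/- Let A be a complex Banach algebra with identity and let a ∈ A. If a has a generalized Hirano inverse, then for every natural number n ≥ 1 the element aⁿ has a generalized Hirano inverse. -/
open Filter Topology in
lemma quasinil_pow_small {A : Type*} [NormedRing A] [NormedAlgebra ℂ A] [CompleteSpace A] (q : A)
    (h : Quasinilpotent q) (M : ℝ) (hM : 0 ≤ M) : ∃ n : ℕ, 0 < n ∧ ‖q ^ n‖ * M ^ n < 1 := by
  have hs : spectralRadius ℂ q = 0 := by
    rw [spectralRadius]
    simp only [ENNReal.iSup_eq_zero]
    intro k hk
    by_contra hne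
    have hk0 : k ≠ 0 := by
      rintro rfl
      simp at hne
    apply hk
    have h1 := h (algebraMap ℂ A (-k⁻¹)) (Algebra.commutes _ _)
    have h2 : algebraMap ℂ A k - q = algebraMap ℂ A k * (1 + q * algebraMap ℂ A (-k⁻¹)) := by
      rw [mul_add, mul_one, ← Algebra.commutes (-k⁻¹) q, ← mul_assoc, ← map_mul]
      simp [hk0, sub_eq_add_neg]
    rw [spectrum.mem_resolventSet_iff, h2]
    exact ((IsUnit.mk0 k hk0).map (algebraMap ℂ A)).mul h1
  have ht := spectrum.pow_nnnorm_pow_one_div_tendsto_nhds_spectralRadius q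
  rw [hs] at ht
  have hpos : (0 : ENNReal) < ENNReal.ofReal (1 / (M + 1)) := by
    rw [ENNReal.ofReal_pos]; positivity
  obtain ⟨n, hn, hn0⟩ := ((ht.eventually (gt_mem_nhds hpos)).and (eventually_gt_atTop 0)).exists
  refine ⟨n, hn0, ?_⟩
  have h3 : (‖q ^ n‖₊ : ENNReal) < ENNReal.ofReal (1 / (M + 1)) ^ n := by
    have h4 := ENNReal.rpow_lt_rpow hn (show (0 : ℝ) < n by exact_mod_cast hn0)
    rw [← ENNReal.rpow_mul, one_div_mul_cancel (by positivity), ENNReal.rpow_one,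
      ENNReal.rpow_natCast] at h4
    exact h4
  rw [← ENNReal.ofReal_pow (by positivity), ← enorm_eq_nnnorm, ← ofReal_norm,
    ENNReal.ofReal_lt_ofReal_iff (by positivity)] at h3
  calc ‖q ^ n‖ * M ^ n ≤ ‖q ^ n‖ * (M + 1) ^ n := by gcongr; linarith
    _ < (1 / (M + 1)) ^ n * (M + 1) ^ n := by gcongr
    _ = 1 := by rw [← mul_pow, one_div_mul_cancel (by positivity), one_pow]

lemma quasinil_mul {A : Type*} [NormedRing A] [NormedAlgebra ℂ A] [CompleteSpace A] (q c : A)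
    (h : Quasinilpotent q) (hc : Commute q c) : Quasinilpotent (q * c) := by
  intro x hx
  have hx' : Commute (q * c) x := hx.symm
  obtain ⟨n, hn, hlt⟩ := quasinil_pow_small q h (‖c‖ * ‖x‖) (by positivity)
  have hnorm : ‖(-(q * c * x)) ^ n‖ < 1 := by
    have e : ‖(-(q * c * x)) ^ n‖ = ‖(q * c * x) ^ n‖ := by
      rcases n.even_or_odd with hp | hp
      · rw [hp.neg_pow]
      · rw [hp.neg_pow, norm_neg]
    rw [e, hx'.mul_pow, hc.mul_pow]
    refine lt_of_le_of_lt ?_ hlt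
    rw [mul_pow, ← mul_assoc]
    refine (norm_mul_le _ _).trans ?_
    gcongr
    · refine (norm_mul_le _ _).trans ?_
      gcongr
      exact norm_pow_le' c hn
    · exact norm_pow_le' x hn
  have hu : IsUnit (1 - (-(q * c * x)) ^ n) := isUnit_one_sub_of_norm_lt_one hnorm
  have e1 := mul_neg_geom_sum (-(q * c * x)) n
  have e2 := geom_sum_mul_neg (-(q * c * x)) n
  rw [← e1, Commute.isUnit_mul_iff (e1.trans e2.symm)] at hu
  simpa using hu.1

theorem stmt3 {A : Type*} [NormedRing A] [NormedAlgebra ℂ A] [CompleteSpace A] (a : A)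
    (h : ∃ b, IsGenHiranoInv a b) : ∀ n : ℕ, 1 ≤ n → ∃ b, IsGenHiranoInv (a ^ n) b := by
  obtain ⟨b, h1, h2, h3⟩ := h
  intro n _
  have hab : Commute a b := h2
  refine ⟨b ^ n, ?_, (hab.pow_pow n n).eq, ?_⟩
  · rw [← hab.symm.mul_pow, ← ((Commute.refl b).mul_left hab).mul_pow, ← h1]
  · have hcm : Commute (a ^ 2) (a * b) :=
      ((Commute.refl a).pow_left 2).mul_right (hab.pow_left 2)
    have e1 := hcm.mul_geom_sum₂ n
    have e2 := hcm.geom_sum₂_mul n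
    have := quasinil_mul _ _ h3 (e1.trans e2.symm)
    rw [e1, hab.mul_pow, ← pow_mul, mul_comm 2 n, pow_mul] at this
    exact this
end

section
/- Let A be a complex Banach algebra with identity and let a ∈ A. The following are equivalent: (1) a has a generalized Hirano inverse; (2) there exists e ∈ A with e³ = e, ea = ae, and a − e ∈ A^{qnil}. -/
def PQ {A : Type*} [NormedRing A] (a : A) : Prop :=
  ∀ ε : ℝ, 0 < ε → ∃ C : ℝ, ∀ n : ℕ, ‖a ^ n‖ ≤ C * ε ^ n

section
variable {A : Type*} [NormedRing A]

lemma PQ.nonneg {a : A} {C ε : ℝ} (h : ∀ n : ℕ, ‖a ^ n‖ ≤ C * ε ^ n) : 0 ≤ C := by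
  have := h 0
  simp only [pow_zero, mul_one] at this
  exact (norm_nonneg _).trans this

lemma PQ.mul {a x : A} (h : PQ a) (hx : Commute a x) : PQ (a * x) := by
  intro ε hε
  set M := ‖x‖ + 1
  have hM : 0 < M := by positivity
  obtain ⟨C, hC⟩ := h (ε / M) (by positivity)
  have hC0 := PQ.nonneg hC
  refine ⟨C * max 1 ‖(1 : A)‖, fun n => ?_⟩
  rw [hx.mul_pow]
  have h2 : ‖x ^ n‖ ≤ max 1 ‖(1 : A)‖ * M ^ n := by
    rcases Nat.eq_zero_or_pos n with rfl | hn
    · simp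
    · calc ‖x ^ n‖ ≤ ‖x‖ ^ n := norm_pow_le' x hn
        _ ≤ M ^ n := by gcongr; simp [M]
        _ ≤ _ := le_mul_of_one_le_left (by positivity) (le_max_left _ _)
  calc ‖a ^ n * x ^ n‖ ≤ ‖a ^ n‖ * ‖x ^ n‖ := norm_mul_le _ _
    _ ≤ (C * (ε / M) ^ n) * (max 1 ‖(1 : A)‖ * M ^ n) := by
        gcongr
        exact hC n
    _ = _ := by rw [div_pow]; field_simp

lemma PQ.add {a b : A} (ha : PQ a) (hb : PQ b) (hx : Commute a b) : PQ (a + b) := by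
  intro ε hε
  obtain ⟨C, hC⟩ := ha (ε / 2) (by positivity)
  obtain ⟨D, hD⟩ := hb (ε / 2) (by positivity)
  have hC0 := PQ.nonneg hC
  have hD0 := PQ.nonneg hD
  refine ⟨C * D, fun n => ?_⟩
  rw [hx.add_pow']
  calc _ ≤ ∑ m ∈ Finset.HasAntidiagonal.antidiagonal n, ‖n.choose m.1 • (a ^ m.1 * b ^ m.2)‖ := norm_sum_le _ _
    _ ≤ ∑ m ∈ Finset.HasAntidiagonal.antidiagonal n, n.choose m.1 • (C * (ε/2) ^ m.1 * (D * (ε/2) ^ m.2)) := by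
        refine Finset.sum_le_sum fun m _ => ?_
        refine (norm_nsmul_le).trans ?_
        rw [nsmul_eq_mul]
        gcongr
        refine (norm_mul_le _ _).trans ?_
        gcongr
        · exact hC _
        · exact hD _
    _ = C * D * ∑ m ∈ Finset.HasAntidiagonal.antidiagonal n, n.choose m.1 • ((ε/2) ^ m.1 * ((ε/2) ^ m.2)) := by
        rw [Finset.mul_sum]
        refine Finset.sum_congr rfl fun m _ => ?_
        simp only [nsmul_eq_mul]; ring
    _ = _ := by
        rw [← (Commute.all (ε/2) (ε/2)).add_pow']; simp

lemma PQ.of_sq {a : A} (h : PQ (a ^ 2)) : PQ a := by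
  intro ε hε
  obtain ⟨C, hC⟩ := h (ε ^ 2) (by positivity)
  have hC0 := PQ.nonneg hC
  refine ⟨max C (C * ‖a‖ / ε), fun n => ?_⟩
  rcases Nat.even_or_odd' n with ⟨k, rfl | rfl⟩
  · rw [pow_mul, pow_mul]
    exact (hC k).trans (by gcongr; exact le_max_left _ _)
  · rw [pow_succ a, pow_mul a, pow_succ ε, pow_mul ε]
    calc _ ≤ ‖(a ^ 2) ^ k‖ * ‖a‖ := norm_mul_le _ _
      _ ≤ C * (ε ^ 2) ^ k * ‖a‖ := by gcongr; exact hC k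
      _ = (C * ‖a‖ / ε) * ((ε ^ 2) ^ k * ε) := by field_simp
      _ ≤ _ := by gcongr; exact le_max_right _ _

lemma PQ.neg {a : A} (h : PQ a) : PQ (-a) := by
  have := h.mul (x := -1) (by simp)
  simpa using this

variable [CompleteSpace A]

lemma PQ.summable {a : A} (h : PQ a) (c : ℕ → ℕ) (hc : ∀ n, c n ≤ 4 ^ n) :
    Summable fun n => ‖c n • a ^ n‖ := by
  obtain ⟨C, hC⟩ := h (1/8) (by positivity)
  have hC0 := PQ.nonneg hC
  refine Summable.of_nonneg_of_le (fun _ => norm_nonneg _) (fun n => ?_)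
    ((summable_geometric_two).mul_left C)
  refine norm_nsmul_le.trans ?_
  calc (c n : ℝ) * ‖a ^ n‖ ≤ 4 ^ n * (C * (1/8) ^ n) := by
        gcongr
        · exact_mod_cast hc n
        · exact hC n
    _ = _ := by
        rw [mul_left_comm, ← mul_pow]; norm_num

lemma PQ.isUnit {a : A} (h : PQ a) : IsUnit (1 + a) := by
  have hs : Summable fun n => ((-a) ^ n) := by
    have := (h.neg.summable (fun _ => 1) (fun n => Nat.one_le_pow _ _ (by norm_num))).of_norm
    simpa using this
  have h1 := hs.tsum_pow_mul_one_sub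
  have h2 := hs.one_sub_mul_tsum_pow
  rw [sub_neg_eq_add] at h1 h2
  exact ⟨⟨_, _, h2, h1⟩, rfl⟩

lemma PQ.quasi {a : A} (h : PQ a) : Quasinilpotent a := fun x hx =>
  (h.mul hx.symm).isUnit

lemma PQ.add_isUnit {a u : A} (h : PQ a) (hu : IsUnit u) (hc : Commute a u) : IsUnit (u + a) := by
  obtain ⟨u, rfl⟩ := hu
  have h1 := (h.mul (hc.units_inv_right)).isUnit
  have : (u : A) + a = (1 + a * ↑u⁻¹) * u := by simp [add_mul, mul_assoc]
  rw [this]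
  exact h1.mul u.isUnit

lemma catalan_le (n : ℕ) : catalan n ≤ 4 ^ n := by
  rw [catalan_eq_centralBinom_div]
  refine (Nat.div_le_self _ _).trans ?_
  rw [Nat.centralBinom]
  refine (Nat.choose_le_two_pow _ _).trans ?_
  rw [pow_mul]; norm_num

lemma PQ.lift {x : A} (h : PQ x) : ∃ s : A, s = 1 + x * (s * s) ∧ ∀ y, Commute y x → Commute y s := by
  have hs := h.summable catalan catalan_le
  refine ⟨∑' n, catalan n • x ^ n, ?_, ?_⟩
  · rw [tsum_mul_tsum_eq_tsum_sum_antidiagonal_of_summable_norm hs hs]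
    rw [← Summable.tsum_mul_left]
    · rw [hs.of_norm.tsum_eq_zero_add]
      congr 1
      · simp
      · congr 1
        ext n
        rw [catalan_succ', Finset.sum_smul, Finset.mul_sum]
        refine Finset.sum_congr rfl fun m hm => ?_
        rw [Finset.HasAntidiagonal.mem_antidiagonal] at hm
        rw [← hm]
        rw [smul_mul_smul_comm, mul_smul_comm, pow_succ', pow_add]
    · exact (summable_norm_sum_mul_antidiagonal_of_summable_norm hs hs).of_norm
  · intro y hy
    exact Commute.tsum_right _ fun n => (hy.pow_right n).smul_right _

lemma Quasinilpotent.pq [NormedAlgebra ℂ A] {a : A} (h : Quasinilpotent a) : PQ a := by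
  have hr : spectralRadius ℂ a = 0 := by
    rw [spectralRadius]
    simp only [ENNReal.iSup_eq_zero]
    intro k hk
    by_contra hne
    have hk0 : k ≠ 0 := by rintro rfl; simp at hne
    apply hk
    have h1 := h (algebraMap ℂ A (-k⁻¹)) (Algebra.commutes _ _)
    have h2 := (((IsUnit.mk0 k hk0).map (algebraMap ℂ A))).mul h1
    have : algebraMap ℂ A k - a = algebraMap ℂ A k * (1 + a * algebraMap ℂ A (-k⁻¹)) := by
      rw [← Algebra.commutes (-k⁻¹) a, mul_add, ← mul_assoc, ← map_mul]
      simp [hk0, sub_eq_add_neg]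
    rwa [spectrum.mem_resolventSet_iff, this]
  intro ε hε
  have ht := spectrum.pow_norm_pow_one_div_tendsto_nhds_spectralRadius a
  rw [hr] at ht
  have he := ht.eventually (gt_mem_nhds (show (0 : ENNReal) < ENNReal.ofReal ε by simpa using hε))
  have hO : Asymptotics.IsBigO Filter.atTop (fun n : ℕ => a ^ n) (fun n : ℕ => ε ^ n) := by
    refine Asymptotics.IsBigO.of_bound 1 ?_
    filter_upwards [he, Filter.eventually_gt_atTop 0] with n hn hn0
    rw [ENNReal.ofReal_lt_ofReal_iff hε] at hn
    rw [one_mul, Real.norm_of_nonneg (by positivity)]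
    calc ‖a ^ n‖ = (‖a ^ n‖ ^ (1 / n : ℝ)) ^ n := by
          rw [one_div, Real.rpow_inv_natCast_pow (norm_nonneg _) hn0.ne']
      _ ≤ ε ^ n := by gcongr
  obtain ⟨C, -, hC⟩ := Asymptotics.bound_of_isBigO_nat_atTop hO
  refine ⟨C, fun n => ?_⟩
  have := hC (x := n) (by positivity)
  rwa [Real.norm_of_nonneg (by positivity)] at this

end

theorem stmt5 {A : Type*} [NormedRing A] [NormedAlgebra ℂ A] [CompleteSpace A] (a : A) :
    (∃ b, IsGenHiranoInv a b) ↔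
      (∃ e : A, e ^ 3 = e ∧ e * a = a * e ∧ Quasinilpotent (a - e)) := by
  constructor
  · rintro ⟨b, hb, hab, hq⟩
    have hq := hq.pq
    obtain ⟨f, hf⟩ : ∃ f, f = a * b := ⟨_, rfl⟩
    rw [← hf] at hq
    have hff : f * f = f := by
      rw [hf, mul_assoc, ← mul_assoc b, ← hb]
    have haf : Commute a f := by
      rw [hf]; exact (Commute.refl a).mul_right hab
    obtain ⟨q, hqd⟩ : ∃ q, q = a ^ 2 - f := ⟨_, rfl⟩
    rw [← hqd] at hq
    have haq : Commute a q := by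
      rw [hqd]; exact ((Commute.refl a).pow_right 2).sub_right haf
    have hfq : Commute f q := by
      rw [hqd]; exact (haf.symm.pow_right 2).sub_right (Commute.refl f)
    -- square root of `1 + q f`
    obtain ⟨x, hx⟩ : ∃ x : A, x = q * (f * algebraMap ℂ A (-1/4)) := ⟨_, rfl⟩
    have hcc : ∀ y : A, ∀ c : ℂ, Commute y (algebraMap ℂ A c) := fun y c =>
      (Algebra.commutes c y).symm
    have hxq : PQ x := by
      rw [hx]
      exact hq.mul (hfq.symm.mul_right (hcc _ _))
    have hx4 : 4 * x = -(q * f) := by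
      have h4 : (4 : A) = algebraMap ℂ A 4 := (map_ofNat (algebraMap ℂ A) 4).symm
      rw [hx, h4, (hcc _ _).symm.eq]
      simp only [mul_assoc, ← map_mul]
      norm_num
    have hax : Commute a x := by
      rw [hx]; exact haq.mul_right (haf.mul_right (hcc _ _))
    have hfx : Commute f x := by
      rw [hx]; exact hfq.mul_right ((Commute.refl f).mul_right (hcc _ _))
    obtain ⟨s, hs, hsc⟩ := hxq.lift
    have hxs := hsc x (Commute.refl x)
    obtain ⟨t, ht⟩ : ∃ t, t = x * s := ⟨_, rfl⟩
    have htq : PQ t := by rw [ht]; exact hxq.mul hxs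
    have hat : Commute a t := by rw [ht]; exact hax.mul_right (hsc _ hax)
    have hft : Commute f t := by rw [ht]; exact hfx.mul_right (hsc _ hfx)
    have htt : t = x + t * t := by
      have : t * t = x * (x * (s * s)) := by
        rw [ht, hxs.symm.mul_mul_mul_comm, mul_assoc]
      rw [this, ht]
      conv_lhs => rw [hs]
      rw [mul_add, mul_one]
    have h2 : PQ (-(t * 2)) := (htq.mul (by exact_mod_cast Nat.commute_cast t 2)).neg
    obtain ⟨v, hv⟩ := h2.isUnit
    have hav : Commute a v := by
      rw [hv]
      exact (Commute.one_right a).add_right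
        (hat.mul_right (by exact_mod_cast Nat.commute_cast a 2)).neg_right
    have hfv : Commute f v := by
      rw [hv]
      exact (Commute.one_right f).add_right
        (hft.mul_right (by exact_mod_cast Nat.commute_cast f 2)).neg_right
    have hvv : (v : A) * v = 1 + q * f := by
      rw [← neg_neg (q * f), ← hx4, hv]
      have : x = t - t * t := eq_sub_of_add_eq htt.symm
      rw [this]
      noncomm_ring
    have hav' : Commute a (↑v⁻¹ : A) := hav.units_inv_right
    have hfv' : Commute f (↑v⁻¹ : A) := hfv.units_inv_right
    have hafv : Commute (a * f) (↑v⁻¹ : A) := hav'.mul_left hfv'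
    obtain ⟨e, he⟩ : ∃ e : A, e = a * f * ↑v⁻¹ := ⟨_, rfl⟩
    have haaf : (a * f) * (a * f) = f * (v * v) := by
      rw [hvv, haf.symm.mul_mul_mul_comm, hff, ← pow_two, hfq.symm.eq, mul_add, ← mul_assoc, hff,
        mul_one, hfq.eq]
      rw [hqd, sub_mul, hff]; abel
    have hee : e * e = f := by
      rw [he, hafv.symm.mul_mul_mul_comm, haaf]
      simp [mul_assoc]
    have hef : e * f = e := by
      rw [he, mul_assoc, ← hfv'.eq, ← mul_assoc, mul_assoc a, hff]
    have hae : Commute a e := by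
      rw [he]; exact ((Commute.refl a).mul_right haf).mul_right hav'
    refine ⟨e, ?_, hae.symm, ?_⟩
    · rw [pow_succ', pow_two, hee, hef]
    · have hdec : a - e = a * (1 - f) + (-(t * 2)) * (a * f * ↑v⁻¹) := by
        have : -(t * 2) = v - 1 := by rw [hv]; abel
        rw [this, sub_mul, one_mul, hafv.eq, Units.mul_inv_cancel_left, he, hafv.eq]
        noncomm_ring
      rw [hdec]
      have htv : Commute (-(t * 2)) (↑v⁻¹ : A) := by
        refine Commute.units_inv_right ?_
        rw [hv]
        exact (Commute.one_right _).add_right (Commute.refl _)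
      have h2a : Commute a (-(t * 2)) :=
        (hat.mul_right (by exact_mod_cast Nat.commute_cast a 2)).neg_right
      have h2f : Commute f (-(t * 2)) :=
        (hft.mul_right (by exact_mod_cast Nat.commute_cast f 2)).neg_right
      have ha1 : Commute a (1 - f) := (Commute.one_right a).sub_right haf
      refine (PQ.add (PQ.of_sq ?_) (h2.mul ?_) ?_).quasi
      · rw [ha1.mul_pow]
        have : a ^ 2 * (1 - f) ^ 2 = q * (1 - f) := by
          rw [hqd, pow_two (1 - f)]
          have h1 : (1 - f) * (1 - f) = 1 - f := by
            simp [mul_sub, sub_mul, hff]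
          rw [h1, sub_mul, mul_sub f, hff]; simp
        rw [this]
        exact hq.mul ((Commute.one_right q).sub_right hfq.symm)
      · exact (h2a.symm.mul_right h2f.symm).mul_right htv
      · have c1 : Commute a (a * f * ↑v⁻¹) := ((Commute.refl a).mul_right haf).mul_right hav'
        have c2 : Commute f (a * f * ↑v⁻¹) :=
          (haf.symm.mul_right (Commute.refl f)).mul_right hfv'
        have d1 := h2a.mul_right c1
        have d2 := h2f.mul_right c2
        exact d1.mul_left ((Commute.one_left _).sub_left d2)
  · rintro ⟨e, he, hea, hw⟩
    have hw := hw.pq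
    have hae : Commute a e := hea.symm
    have hwe : Commute (a - e) e := hae.sub_left (Commute.refl e)
    obtain ⟨f, hf⟩ : ∃ f, f = e * e := ⟨_, rfl⟩
    have hef : e * f = e := by rw [hf, ← pow_two, ← pow_succ', he]
    have hfe : f * e = e := by rw [hf, ← pow_two, ← pow_succ, he]
    have hff : f * f = f := by
      nth_rw 1 [hf]; rw [mul_assoc, hef, hf]
    have haf : Commute a f := by rw [hf]; exact hae.mul_right hae
    have hwf : Commute (a - e) f := by rw [hf]; exact hwe.mul_right hwe
    have hun : (e + 1 - f) * (e + 1 - f) = 1 := by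
      simp only [mul_add, add_mul, mul_sub, sub_mul, hef, hfe, hff, ← hf]
      simp
    have hun' : IsUnit (e + 1 - f) := ⟨⟨_, _, hun, hun⟩, rfl⟩
    have hc : Commute ((a - e) * f) (e + 1 - f) := by
      have d1 : Commute (a - e) (e + 1 - f) :=
        (hwe.add_right (Commute.one_right _)).sub_right hwf
      have d2 : Commute f (e + 1 - f) :=
        (Commute.add_right (hfe.trans hef.symm) (Commute.one_right _)).sub_right (Commute.refl f)
      exact d1.mul_left d2
    obtain ⟨u, hu⟩ := (hw.mul hwf).add_isUnit hun' hc
    have hu2 : (u : A) = a * f + 1 - f := by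
      rw [hu, sub_mul, hef]; abel
    have hau : Commute a u := by
      rw [hu2]
      exact (((Commute.refl a).mul_right haf).add_right (Commute.one_right _)).sub_right haf
    have hfu : Commute f u := by
      rw [hu2]
      exact ((haf.symm.mul_right (Commute.refl f)).add_right
        (Commute.one_right _)).sub_right (Commute.refl f)
    have hau' : Commute a (↑u⁻¹ : A) := hau.units_inv_right
    have hfu' : Commute f (↑u⁻¹ : A) := hfu.units_inv_right
    have huf : a * f = f * u := by
      rw [hfu.eq, hu2, sub_mul, add_mul, mul_assoc, hff]; simp
    have hab : a * (f * ↑u⁻¹) = f := by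
      rw [← mul_assoc, huf, Units.mul_inv_cancel_right]
    refine ⟨f * ↑u⁻¹, ?_, haf.mul_right hau', ?_⟩
    · rw [mul_assoc, hab, mul_assoc, ← hfu'.eq, ← mul_assoc, hff]
    · rw [hab]
      have : a ^ 2 - f = (a - e) * (a + e) := by
        rw [hf, mul_add, sub_mul, sub_mul, hae.eq]; rw [pow_two]; abel
      rw [this]
      exact (hw.mul (((Commute.refl a).sub_left hae.symm).add_right hwe)).quasi
end

section
/- Let A be an n × n matrix over the complex numbers ℂ. The following are equivalent: (1) A has a generalized Hirano inverse in the Banach algebra M_n(ℂ); (2) A = E + N where E³ = E, N is nilpotent, and EN = NE; (3) every eigenvalue of A is −1, 0 or 1 (i.e., the spectrum of A is contained in {−1, 0, 1}). -/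
open Polynomial in
theorem nil_of_spec {n : ℕ} (Q : Matrix (Fin n) (Fin n) ℂ)
    (h : ∀ r ∈ spectrum ℂ Q, r = 0) : IsNilpotent Q := by
  have hr : Q.charpoly.roots = Multiset.replicate Q.charpoly.roots.card 0 := by
    rw [Multiset.eq_replicate]
    refine ⟨rfl, fun r hr => h r ?_⟩
    rw [Matrix.mem_spectrum_iff_isRoot_charpoly]
    exact isRoot_of_mem_roots hr
  have hs : Q.charpoly.Splits := IsAlgClosed.splits _
  have hp := hs.eq_prod_roots_of_monic (Matrix.charpoly_monic Q)
  rw [hr] at hp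
  have hc := Matrix.aeval_self_charpoly Q
  rw [hp] at hc
  simp at hc
  exact ⟨_, hc⟩

theorem nil_of_quasi {n : ℕ} (Q : Matrix (Fin n) (Fin n) ℂ)
    (h : Quasinilpotent Q) : IsNilpotent Q := by
  apply nil_of_spec
  intro r hr
  by_contra h0
  apply hr
  have h1 := h (algebraMap ℂ _ (-r⁻¹)) (Algebra.commutes _ _)
  have h2 : IsUnit (algebraMap ℂ (Matrix (Fin n) (Fin n) ℂ) r) :=
    (isUnit_iff_ne_zero.mpr h0).map _
  have h3 := h1.mul h2
  rw [add_mul, one_mul, mul_assoc, ← map_mul, neg_mul, inv_mul_cancel₀ h0] at h3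
  rw [spectrum.mem_resolventSet_iff]
  simpa [sub_eq_add_neg] using h3

theorem quasi_of_nil {R : Type*} [Ring R] (q : R) (h : IsNilpotent q) : Quasinilpotent q := by
  intro x hx
  exact ((show Commute q x from hx.symm).isNilpotent_mul_right h).isUnit_one_add

theorem nil_of_hirano {n : ℕ} (A B : Matrix (Fin n) (Fin n) ℂ)
    (h : IsGenHiranoInv A B) : IsNilpotent (A ^ 3 - A) := by
  obtain ⟨h1, h2, h3⟩ := h
  have hQ := nil_of_quasi _ h3
  have hAB : Commute A B := h2
  have hAQ : Commute A (A ^ 2 - A * B) :=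
    (Commute.pow_right (Commute.refl A) 2).sub_right ((Commute.refl A).mul_right hAB)
  have hBQ : Commute B (A ^ 2 - A * B) :=
    (hAB.symm.pow_right 2).sub_right (hAB.symm.mul_right (Commute.refl B))
  have he : A * B * (A * B) = A * B := by
    calc A * B * (A * B) = A * (B * A * B) := by noncomm_ring
      _ = A * B := by rw [← h1]
  have n1 : IsNilpotent (A * (A ^ 2 - A * B)) := hAQ.isNilpotent_mul_left hQ
  have n2 : IsNilpotent (A * (1 - A * B)) := by
    have hc : Commute (1 - A * B) (A ^ 2 - A * B) :=
      (Commute.one_left _).sub_left (hAQ.mul_left hBQ)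
    have hc2 : Commute A (1 - A * B) :=
      (Commute.one_right _).sub_right ((Commute.refl A).mul_right hAB)
    have : (A * (1 - A * B)) ^ 2 = (1 - A * B) * (A ^ 2 - A * B) := by
      have e1 : (1 - A * B) * (1 - A * B) = 1 - A * B := by
        simp only [sub_mul, mul_sub, he, one_mul, mul_one]; abel
      have e2 : (1 - A * B) * (A * B) = 0 := by
        simp only [sub_mul, he, one_mul, sub_self]
      rw [hc2.mul_pow, pow_two (1 - A * B), e1, mul_sub (1 - A * B), e2, sub_zero,
        (hc2.pow_left 2).eq]
    have h4 : IsNilpotent ((A * (1 - A * B)) ^ 2) := by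
      rw [this]; exact hc.isNilpotent_mul_left hQ
    exact IsNilpotent.of_pow h4
  have hcc : Commute (A * (A ^ 2 - A * B)) (A * (1 - A * B)) := by
    have hA1 : Commute A (1 - A * B) :=
      (Commute.one_right _).sub_right ((Commute.refl A).mul_right hAB)
    have hc : Commute (A ^ 2 - A * B) (1 - A * B) :=
      (Commute.one_right _).sub_right (hAQ.symm.mul_right hBQ.symm)
    exact ((Commute.refl A).mul_right hA1).mul_left (hAQ.symm.mul_right hc)
  have := hcc.isNilpotent_sub n1 n2
  have e : A ^ 3 - A = A * (A ^ 2 - A * B) - A * (1 - A * B) := by noncomm_ring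
  rw [e]
  exact this

open Polynomial in
theorem decomp_of_nil {n : ℕ} (A : Matrix (Fin n) (Fin n) ℂ)
    (h : IsNilpotent (A ^ 3 - A)) : ∃ E N : Matrix (Fin n) (Fin n) ℂ,
        E ^ 3 = E ∧ IsNilpotent N ∧ E * N = N * E ∧ A = E + N := by
  set a : Algebra.adjoin ℂ {A} := ⟨A, Algebra.self_mem_adjoin_singleton ℂ A⟩ with ha
  have ha3 : IsNilpotent (a ^ 3 - a) := by
    obtain ⟨k, hk⟩ := h
    exact ⟨k, Subtype.ext (by simpa [ha] using hk)⟩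
  have h1 : IsNilpotent (aeval a (X ^ 3 - X : ℂ[X])) := by simpa using ha3
  have h2 : IsUnit (aeval a (derivative (X ^ 3 - X : ℂ[X]))) := by
    have e : aeval a (derivative (X ^ 3 - X : ℂ[X])) = 3 * a ^ 2 - 1 := by
      simp [map_ofNat]
      norm_num
    rw [e]
    have hu : IsUnit (2 : Algebra.adjoin ℂ {A}) := by
      have := (isUnit_iff_ne_zero.mpr (two_ne_zero (α := ℂ))).map
        (algebraMap ℂ (Algebra.adjoin ℂ {A}))
      rwa [map_ofNat] at this
    have hn : IsNilpotent (9 * a * (a ^ 3 - a)) := (Commute.all _ _).isNilpotent_mul_left ha3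
    have h3 := hn.isUnit_add_left_of_commute hu (Commute.all _ _)
    refine isUnit_of_mul_isUnit_left (y := 3 * a ^ 2 - 2) ?_
    convert h3 using 1
    ring
  obtain ⟨s, ⟨⟨k, hk⟩, hs⟩, -⟩ := existsUnique_nilpotent_sub_and_aeval_eq_zero h1 h2
  have hc : s * (a - s) = (a - s) * s := mul_comm _ _
  have hs' : s ^ 3 = s := by simpa [sub_eq_zero] using hs
  refine ⟨s, A - s, ?_, ⟨k, ?_⟩, ?_, by simp⟩
  · simpa using congrArg Subtype.val hs'
  · simpa using congrArg Subtype.val hk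
  · simpa using congrArg Subtype.val hc

theorem hirano_of_decomp {R : Type*} [Ring R] (E N : R) (hE : E ^ 3 = E) (hN : IsNilpotent N)
    (hc : E * N = N * E) : ∃ B, IsGenHiranoInv (E + N) B := by
  have hEN : Commute E N := hc
  obtain ⟨u, hu⟩ := (hEN.isNilpotent_mul_left hN).isUnit_one_add
  have hEu : Commute E (u : R) := by
    rw [hu]
    exact (Commute.one_right _).add_right ((Commute.refl E).mul_right hEN)
  have hNu : Commute N (u : R) := by
    rw [hu]
    exact (Commute.one_right _).add_right (hEN.symm.mul_right (Commute.refl N))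
  have hEv : Commute E (↑u⁻¹ : R) := hEu.units_inv_right
  have hNv : Commute N (↑u⁻¹ : R) := hNu.units_inv_right
  have e3 : E * E * E = E := by rw [← hE]; simp only [hE]; rw [← pow_two, ← pow_succ, hE]
  have key : (E + N) * (E * ↑u⁻¹) = E ^ 2 := by
    rw [← mul_assoc, Units.mul_inv_eq_iff_eq_mul, hu, mul_add, mul_one, add_mul, ← mul_assoc, ← pow_succ,
      hE, ← hc, pow_two]
  have hAB : Commute (E + N) (E * ↑u⁻¹) :=
    ((Commute.refl E).mul_right hEv).add_left (hEN.symm.mul_right hNv)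
  refine ⟨E * ↑u⁻¹, ?_, hAB.eq, ?_⟩
  · rw [← hAB.eq, key, ← mul_assoc, ← pow_succ, hE]
  · apply quasi_of_nil
    rw [key]
    have : (E + N) ^ 2 - E ^ 2 = (2 * E + N) * N := by
      have : (E + N) ^ 2 - E ^ 2 = E * N + N * E + N * N := by noncomm_ring
      rw [this, ← hc]; noncomm_ring
    rw [this]
    have hcc : Commute (2 * E + N) N :=
      ((Commute.ofNat_left 2 N).mul_left hEN).add_left (Commute.refl N)
    exact hcc.isNilpotent_mul_left hN

open Polynomial in
theorem spec_iff {n : ℕ} (hn : 1 ≤ n) (A : Matrix (Fin n) (Fin n) ℂ) :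
    IsNilpotent (A ^ 3 - A) ↔ spectrum ℂ A ⊆ {-1, 0, 1} := by
  have : Nonempty (Fin n) := ⟨⟨0, hn⟩⟩
  have e : aeval A (X ^ 3 - X : ℂ[X]) = A ^ 3 - A := by simp
  have hroot : ∀ r : ℂ, r ^ 3 - r = 0 ↔ r ∈ ({-1, 0, 1} : Set ℂ) := by
    intro r
    have : r ^ 3 - r = (r + 1) * (r * (r - 1)) := by ring
    rw [this, mul_eq_zero, mul_eq_zero, sub_eq_zero, add_eq_zero_iff_eq_neg]
    simp
  constructor
  · intro h r hr
    rw [← hroot]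
    have h1 : (r ^ 3 - r) ∈ spectrum ℂ (A ^ 3 - A) := by
      rw [← e]
      exact spectrum.subset_polynomial_aeval A _ ⟨r, hr, by simp⟩
    by_contra h0
    apply h1
    have h2 : IsUnit (algebraMap ℂ (Matrix (Fin n) (Fin n) ℂ) (r ^ 3 - r)) :=
      (isUnit_iff_ne_zero.mpr h0).map _
    rw [sub_eq_add_neg]
    exact h.neg.isUnit_add_left_of_commute h2 (Algebra.commutes _ _).symm
  · intro h
    apply nil_of_spec
    intro r hr
    rw [← e, spectrum.map_polynomial_aeval_of_nonempty A _
      (spectrum.nonempty_of_isAlgClosed_of_finiteDimensional ℂ A)] at hr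
    obtain ⟨s, hs, rfl⟩ := hr
    simpa using (hroot s).mpr (h hs)

theorem stmt6 (n : ℕ) (hn : 1 ≤ n) (A : Matrix (Fin n) (Fin n) ℂ) :
    ((∃ B, IsGenHiranoInv A B) ↔
      (∃ E N : Matrix (Fin n) (Fin n) ℂ,
        E ^ 3 = E ∧ IsNilpotent N ∧ E * N = N * E ∧ A = E + N)) ∧
    ((∃ B, IsGenHiranoInv A B) ↔ spectrum ℂ A ⊆ {-1, 0, 1}) := by
  have h12 : (∃ B, IsGenHiranoInv A B) ↔ IsNilpotent (A ^ 3 - A) := by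
    constructor
    · rintro ⟨B, hB⟩
      exact nil_of_hirano A B hB
    · intro h
      obtain ⟨E, N, hE, hN, hc, rfl⟩ := decomp_of_nil A h
      exact hirano_of_decomp E N hE hN hc
  refine ⟨⟨fun h => decomp_of_nil A (h12.mp h), ?_⟩, h12.trans (spec_iff hn A)⟩
  rintro ⟨E, N, hE, hN, hc, rfl⟩
  exact hirano_of_decomp E N hE hN hc
end

section
/- Let A be a complex Banach algebra with identity and let a ∈ A. The following are equivalent: (1) a has a generalized Hirano inverse; (2) there exists e ∈ comm²(a) with e³ = e and a − e ∈ A^{qnil}; (3) there exists b ∈ comm²(a) such that b = (ab)² and a² − a²b ∈ A^{qnil}. -/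
open Filter Topology

namespace GH

section
variable {A : Type*} [NormedRing A]

/-- Norms of powers decay faster than any geometric sequence. -/
def Dec (q : A) : Prop := ∀ r : ℝ, 0 < r → ∀ᶠ n : ℕ in atTop, ‖q ^ n‖ ≤ r ^ n

lemma Dec.mul {q x : A} (hq : Dec q) (h : Commute q x) : Dec (q * x) := by
  intro r hr
  have hx : 0 < ‖x‖ + 1 := by positivity
  filter_upwards [hq (r / (‖x‖ + 1)) (by positivity), eventually_gt_atTop 0] with n hn h0
  rw [h.mul_pow]
  calc ‖q ^ n * x ^ n‖ ≤ ‖q ^ n‖ * ‖x ^ n‖ := norm_mul_le _ _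
    _ ≤ (r / (‖x‖ + 1)) ^ n * (‖x‖ + 1) ^ n := by
        gcongr
        exact (norm_pow_le' x h0).trans (by gcongr; linarith)
    _ = r ^ n := by rw [← mul_pow, div_mul_cancel₀ _ hx.ne']

lemma Dec.isUnit [CompleteSpace A] {q : A} (hq : Dec q) : IsUnit (1 - q) := by
  obtain ⟨n, hn, h0⟩ := ((hq (1/2) (by norm_num)).and (eventually_gt_atTop 0)).exists
  have h1 : ‖q ^ n‖ < 1 := hn.trans_lt (pow_lt_one₀ (by norm_num) (by norm_num) h0.ne')
  have h2 : IsUnit (1 - q ^ n) := isUnit_one_sub_of_norm_lt_one h1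
  rw [← mul_neg_geom_sum q n] at h2
  have hc : Commute (1 - q) (∑ i ∈ Finset.range n, q ^ i) := by
    refine Commute.sum_right _ _ _ fun i _ => ?_
    exact (Commute.one_left _).sub_left ((Commute.refl q).pow_right i)
  exact (hc.isUnit_mul_iff.1 h2).1

lemma Dec.neg {q : A} (hq : Dec q) : Dec (-q) := by
  simpa using hq.mul (x := -1) ((Commute.one_right q).neg_right)

lemma Dec.quasi [CompleteSpace A] {q : A} (hq : Dec q) : Quasinilpotent q := by
  intro x hx
  have h : Commute q x := hx.symm
  have := (hq.mul h).neg.isUnit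
  simpa using this

variable [NormedAlgebra ℂ A] [CompleteSpace A]

lemma dec_of_units {q : A} (h : ∀ l : ℂ, IsUnit (1 + l • q)) : Dec q := by
  have hs : spectralRadius ℂ q = 0 := by
    rw [spectralRadius]
    simp only [ENNReal.iSup_eq_zero]
    intro k hk
    by_contra hne
    have hk0 : k ≠ 0 := by rintro rfl; simp at hne
    apply hk
    rw [spectrum.mem_resolventSet_iff]
    have h1 := h (-k⁻¹)
    have : algebraMap ℂ A k - q = algebraMap ℂ A k * (1 + (-k⁻¹) • q) := by
      rw [mul_add, mul_one, Algebra.algebraMap_eq_smul_one, smul_mul_smul_comm]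
      simp [hk0, sub_eq_add_neg]
    rw [this]
    exact ((IsUnit.mk0 k hk0).map (algebraMap ℂ A)).mul h1
  have ht := spectrum.pow_norm_pow_one_div_tendsto_nhds_spectralRadius q
  rw [hs] at ht
  intro r hr
  have h2 := ht.eventually (gt_mem_nhds (ENNReal.ofReal_pos.2 hr))
  filter_upwards [h2, eventually_gt_atTop 0] with n hn h0
  rw [ENNReal.ofReal_lt_ofReal_iff hr] at hn
  calc ‖q ^ n‖ = (‖q ^ n‖ ^ (1 / (n:ℝ))) ^ n := by
        rw [one_div, Real.rpow_inv_natCast_pow (norm_nonneg _) h0.ne']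
    _ ≤ r ^ n := by gcongr

lemma _root_.Quasinilpotent.dec {q : A} (h : Quasinilpotent q) : Dec q := by
  refine dec_of_units fun l => ?_
  have := h (algebraMap ℂ A l) (Algebra.commutes l q)
  rwa [← Algebra.commutes, ← Algebra.smul_def] at this

lemma Dec.unit_smul {q : A} (h : Dec q) (l : ℂ) : IsUnit (1 + l • q) := by
  have := h.quasi (algebraMap ℂ A l) (Algebra.commutes l q)
  rwa [← Algebra.commutes, ← Algebra.smul_def] at this

lemma Dec.add_orth {u v : A} (hu : Dec u) (hv : Dec v) (h : u * v = 0) : Dec (u + v) := by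
  refine dec_of_units fun l => ?_
  have : 1 + l • (u + v) = (1 + l • u) * (1 + l • v) := by
    simp [mul_add, add_mul, h]; abel
  rw [this]
  exact (hu.unit_smul l).mul (hv.unit_smul l)

lemma Dec.of_sq {q : A} (h : Dec (q * q)) : Dec q := by
  refine dec_of_units fun l => ?_
  have h1 := h.unit_smul (-(l * l))
  have : 1 + (-(l * l)) • (q * q) = (1 + l • q) * (1 - l • q) := by
    rw [mul_sub, mul_one, add_mul, one_mul, smul_mul_smul_comm, neg_smul]; abel
  rw [this] at h1
  have hc : Commute (1 + l • q) (1 - l • q) := by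
    refine Commute.add_left (Commute.one_left _) (Commute.sub_right (Commute.one_right _) (Commute.refl _))
  exact (hc.isUnit_mul_iff.1 h1).1

lemma catalan_le (n : ℕ) : (catalan n : ℝ) ≤ 4 ^ n := by
  have h1 : catalan n ≤ Nat.centralBinom n := by
    rw [catalan_eq_centralBinom_div]; exact Nat.div_le_self _ _
  have h2 : Nat.centralBinom n ≤ 4 ^ n := by
    rw [Nat.centralBinom_eq_two_mul_choose]
    calc _ ≤ 2 ^ (2 * n) := Nat.choose_le_two_pow _ _
      _ = 4 ^ n := by rw [pow_mul]; norm_num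
  exact_mod_cast h1.trans h2

/-- A quasinilpotent solution of `w - w^2 = x`. -/
lemma exists_w {x : A} (hx : Dec x) :
    ∃ w : A, w - w * w = x ∧ Dec w ∧ ∀ y, Commute y x → Commute y w := by
  have hs : Summable fun n : ℕ => ‖(catalan n : ℕ) • x ^ n‖ := by
    refine Summable.of_norm_bounded_eventually_nat (g := fun n : ℕ => (1/2:ℝ) ^ n)
      (summable_geometric_of_lt_one (by norm_num) (by norm_num)) ?_
    filter_upwards [hx (1/8) (by norm_num)] with n hn
    rw [norm_norm]
    calc ‖(catalan n : ℕ) • x ^ n‖ ≤ (catalan n : ℝ) * ‖x ^ n‖ := by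
          exact norm_nsmul_le
      _ ≤ 4 ^ n * (1/8) ^ n := by
          gcongr; exact catalan_le n
      _ = (1/2) ^ n := by rw [← mul_pow]; norm_num
  set C : A := ∑' n : ℕ, (catalan n : ℕ) • x ^ n with hC
  have hcomm : ∀ y, Commute y x → Commute y C := by
    intro y hy
    exact Commute.tsum_right y fun n => (hy.pow_right n).smul_right _
  have hcc : C * C = ∑' n : ℕ, (catalan (n+1) : ℕ) • x ^ n := by
    rw [hC, tsum_mul_tsum_eq_tsum_sum_antidiagonal_of_summable_norm hs hs]
    congr 1; ext n
    rw [catalan_succ', Finset.sum_smul]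
    refine Finset.sum_congr rfl fun ij hij => ?_
    rw [Finset.HasAntidiagonal.mem_antidiagonal] at hij
    rw [smul_mul_smul_comm, ← pow_add, hij]
  have hs' : Summable fun n : ℕ => (catalan n : ℕ) • x ^ n := hs.of_norm
  have hs1 : Summable fun n : ℕ => ‖(catalan (n+1) : ℕ) • x ^ n‖ := by
    refine Summable.of_norm_bounded_eventually_nat (g := fun n : ℕ => 4 * (1/2:ℝ) ^ n)
      ((summable_geometric_of_lt_one (by norm_num) (by norm_num)).mul_left 4) ?_
    filter_upwards [hx (1/8) (by norm_num)] with n hn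
    rw [norm_norm]
    calc ‖(catalan (n+1) : ℕ) • x ^ n‖ ≤ (catalan (n+1) : ℝ) * ‖x ^ n‖ := by
          exact norm_nsmul_le
      _ ≤ 4 ^ (n+1) * (1/8) ^ n := by
          gcongr; exact catalan_le _
      _ = 4 * (1/2) ^ n := by rw [pow_succ, mul_right_comm, ← mul_pow, mul_comm]; norm_num
  have hrec : C = 1 + x * (C * C) := by
    rw [hcc, ← hs1.of_norm.tsum_mul_left x, hC, hs'.tsum_eq_zero_add]
    simp only [pow_succ', mul_smul_comm, pow_zero, catalan_zero, one_smul]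
  have hxC : Commute x C := hcomm x (Commute.refl x)
  refine ⟨x * C, ?_, hx.mul hxC, fun y hy => hy.mul_right (hcomm y hy)⟩
  have : x * C * (x * C) = x * (x * (C * C)) := by
    rw [mul_assoc, ← mul_assoc C x C, ← hxC.eq]; simp only [mul_assoc]
  rw [this, ← mul_sub]
  have h3 : C - x * (C * C) = 1 := by nth_rewrite 1 [hrec]; abel
  rw [h3, mul_one]

lemma intertwine_zero {c z u : A} (hu : Dec u) (h : z = c * z * u ∨ z = u * z * c) : z = 0 := by
  have key : ∀ n : ℕ, ‖z‖ ≤ ‖c ^ n‖ * ‖z‖ * ‖u ^ n‖ := by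
    intro n
    rcases h with h | h
    · have : z = c ^ n * z * u ^ n := by
        induction n with
        | zero => simp
        | succ n ih =>
          calc z = c ^ n * z * u ^ n := ih
            _ = c ^ n * (c * z * u) * u ^ n := by rw [← h]
            _ = _ := by rw [pow_succ c, pow_succ' u]; simp only [mul_assoc]
      calc ‖z‖ = ‖c ^ n * z * u ^ n‖ := by rw [← this]
        _ ≤ _ := norm_mul₃_le
    · have : z = u ^ n * z * c ^ n := by
        induction n with
        | zero => simp
        | succ n ih =>
          calc z = u ^ n * z * c ^ n := ih
            _ = u ^ n * (u * z * c) * c ^ n := by rw [← h]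
            _ = _ := by rw [pow_succ u, pow_succ' c]; simp only [mul_assoc]
      calc ‖z‖ = ‖u ^ n * z * c ^ n‖ := by rw [← this]
        _ ≤ ‖u ^ n‖ * ‖z‖ * ‖c ^ n‖ := norm_mul₃_le
        _ = _ := by ring
  have hc : 0 < ‖c‖ + 1 := by positivity
  obtain ⟨n, hn, h0⟩ := ((hu (1 / 2 / (‖c‖ + 1)) (by positivity)).and (eventually_gt_atTop 0)).exists
  have h1 : ‖z‖ ≤ (‖c‖ + 1) ^ n * ‖z‖ * (1 / 2 / (‖c‖ + 1)) ^ n := by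
    refine (key n).trans ?_
    gcongr
    exact (norm_pow_le' c h0).trans (by gcongr; linarith)
  have h2 : (‖c‖ + 1) ^ n * ‖z‖ * (1 / 2 / (‖c‖ + 1)) ^ n = (1/2) ^ n * ‖z‖ := by
    rw [mul_right_comm, ← mul_pow, mul_div_cancel₀ _ hc.ne']
  rw [h2] at h1
  have h3 : ((1:ℝ)/2) ^ n < 1 := pow_lt_one₀ (by norm_num) (by norm_num) h0.ne'
  have : ‖z‖ ≤ 0 := by nlinarith [norm_nonneg z]
  simpa using this

/-- Basic facts on a generalized Hirano inverse. -/
lemma facts {a c : A} (h : IsGenHiranoInv a c) :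
    Dec ((1 - a * c) * a) ∧ ∀ y, Commute y a → Commute y c := by
  obtain ⟨h1, h2, h3⟩ := h
  have hq := h3.dec
  have hac : Commute a c := h2
  obtain ⟨p, hp⟩ : ∃ p, p = a * c := ⟨_, rfl⟩
  rw [← hp] at hq ⊢
  have hcp : c * p = c := by rw [hp, ← mul_assoc, ← h1]
  have hpc : p * c = c := by rw [hp, h2, ← h1]
  have hpp : p * p = p := by nth_rewrite 1 [hp]; rw [mul_assoc, hcp, hp]
  have hpa : Commute p a := by rw [hp]; exact (Commute.refl a).mul_left hac.symm
  have hpa' := hpa.eq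
  have hPa : Commute (1 - p) a := (Commute.one_left a).sub_left hpa
  have hpP : p * (1 - p) = 0 := by rw [mul_sub, hpp, mul_one, sub_self]
  have hPP : (1 - p) * (1 - p) = 1 - p := by rw [sub_mul, hpP, one_mul, sub_zero]
  have hu : Dec ((1 - p) * a) := by
    apply Dec.of_sq
    have e1 : (1 - p) * a * ((1 - p) * a) = (a ^ 2 - p) * (1 - p) := by
      rw [sub_mul (a ^ 2), hpP, sub_zero, ← (hPa.pow_right 2).eq, mul_assoc, ← mul_assoc a,
        ← hPa.eq, mul_assoc, ← mul_assoc (1 - p) (1 - p), hPP, sq]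
    rw [e1]
    exact hq.mul (Commute.sub_right (Commute.one_right _)
      (Commute.sub_left (hpa.symm.pow_left 2) (Commute.refl p)))
  refine ⟨hu, fun y hy => ?_⟩
  have z1 : p * y * (1 - p) = 0 := by
    refine intertwine_zero (c := c) hu (Or.inl ?_)
    calc p * y * (1 - p) = c * (a * y) * (1 - p) := by rw [hp, h2]; simp only [mul_assoc]
      _ = c * p * y * ((1 - p) * (1 - p) * a) := by
          rw [← hy.eq, hcp, hPP, hPa.eq]; simp only [mul_assoc]
      _ = _ := by simp only [mul_assoc]
  have z2 : (1 - p) * y * p = 0 := by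
    refine intertwine_zero (c := c) hu (Or.inr ?_)
    calc (1 - p) * y * p = (1 - p) * (y * a) * c := by rw [hp]; simp only [mul_assoc]
      _ = ((1 - p) * (1 - p) * a) * y * (p * c) := by
          rw [hy.eq, hpc, hPP]; simp only [mul_assoc]
      _ = (1 - p) * ((1 - p) * a) * y * (p * c) := by simp only [mul_assoc]
      _ = (1 - p) * (a * (1 - p)) * y * (p * c) := by rw [hPa.eq]
      _ = _ := by simp only [mul_assoc]
  have hpy : p * y = y * p := by
    have e1 : p * y = p * y * p := by
      rw [mul_sub, mul_one, sub_eq_zero] at z1; exact z1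
    have e2 : y * p = p * y * p := by
      rw [sub_mul, sub_mul, one_mul, sub_eq_zero] at z2; exact z2
    rw [e1, ← e2]
  show y * c = c * y
  calc y * c = y * p * c := by rw [mul_assoc, hpc]
    _ = p * y * c := by rw [hpy]
    _ = c * (a * y) * c := by rw [hp, h2]; simp only [mul_assoc]
    _ = c * (y * p) := by rw [← hy.eq, hp]; simp only [mul_assoc]
    _ = c * y := by rw [← hpy, ← mul_assoc, hcp]

/-- (1) implies (2). -/
lemma one_two {a c : A} (h : IsGenHiranoInv a c) :
    ∃ e : A, (∀ y : A, y * a = a * y → e * y = y * e) ∧ e ^ 3 = e ∧ Quasinilpotent (a - e) := by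
  obtain ⟨hu, hcc⟩ := facts h
  obtain ⟨h1, h2, h3⟩ := h
  have hq := h3.dec
  have hac : Commute a c := h2
  obtain ⟨p, hp⟩ : ∃ p, p = a * c := ⟨_, rfl⟩
  rw [← hp] at hq hu
  have hcp : c * p = c := by rw [hp, ← mul_assoc, ← h1]
  have hpp : p * p = p := by nth_rewrite 1 [hp]; rw [mul_assoc, hcp, hp]
  have hyp : ∀ y, Commute y a → Commute y p := by
    intro y hy; rw [hp]; exact hy.mul_right (hcc y hy)
  have hpa : Commute p a := (hyp a (Commute.refl a)).symm
  have hpP : p * (1 - p) = 0 := by rw [mul_sub, hpp, mul_one, sub_self]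
  have hPp : (1 - p) * p = 0 := by rw [sub_mul, hpp, one_mul, sub_self]
  have hqp : Commute (a ^ 2 - p) p := Commute.sub_left (hpa.symm.pow_left 2) (Commute.refl p)
  obtain ⟨w, hw, hwd, hwc⟩ := exists_w (hq.mul (hqp.smul_right (-(1/4) : ℂ)))
  have hyw : ∀ y, Commute y a → Commute y w := by
    intro y hy
    apply hwc
    exact ((hy.pow_right 2).sub_right (hyp y hy)).mul_right ((hyp y hy).smul_right _)
  have haw : Commute a w := hyw a (Commute.refl a)
  have hpw : Commute p w := hyw p hpa
  obtain ⟨s, hs⟩ : IsUnit (1 - (w + w)) := by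
    have := hwd.unit_smul (-2)
    rwa [neg_smul, two_smul, ← sub_eq_add_neg] at this
  have hys : ∀ y, Commute y a → Commute y (s : A) := by
    intro y hy
    rw [hs]
    exact (Commute.one_right y).sub_right ((hyw y hy).add_right (hyw y hy))
  obtain ⟨t, ht⟩ : ∃ t : A, t = ((s⁻¹ : Aˣ) : A) := ⟨_, rfl⟩
  have hyt : ∀ y, Commute y a → Commute y t := by
    intro y hy
    rw [ht]; exact (hys y hy).units_inv_right
  have hst : (s : A) * t = 1 := by rw [ht]; simp
  have hat := hyt a (Commute.refl a)
  have hpt := hyt p hpa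
  have hwt := hyt w haw.symm
  have hss : (s : A) * s = 1 + (a ^ 2 - p) * p := by
    have e1 : (s : A) * s = 1 - (4 : ℂ) • (w - w * w) := by
      rw [hs, show (4 : ℂ) = 1 + 1 + 1 + 1 by norm_num]
      simp only [add_smul, one_smul]
      noncomm_ring
    rw [e1, hw, mul_smul_comm, smul_smul]
    norm_num
  have hpss : p * ((s : A) * s) = p * (a * a) := by
    rw [hss, mul_add, hqp.eq, ← mul_assoc, hpp, mul_sub, hpp, sq]; simp
  have hee : p * a * t * (p * a * t) = p := by
    calc p * a * t * (p * a * t) = (p * a) * (p * a) * (t * t) := by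
          rw [((hpt.mul_left hat).symm).mul_mul_mul_comm]
      _ = p * (a * a) * (t * t) := by rw [hpa.symm.mul_mul_mul_comm, hpp]
      _ = p * ((s * t) * (s * t)) := by
          rw [← hpss, mul_assoc, (hys t (hat.symm)).mul_mul_mul_comm]
      _ = p := by rw [hst]; simp
  refine ⟨p * a * t, ?_, ?_, ?_⟩
  · intro y hy
    exact (((hyp y hy).mul_right hy).mul_right (hyt y hy)).eq.symm
  · rw [pow_succ, sq, hee, ← mul_assoc, ← mul_assoc, hpp]
  · apply Dec.quasi
    have e1 : 1 - t = w * (-(2 : ℂ) • t) := by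
      rw [mul_smul_comm, neg_smul, two_smul, ← hst, hs]
      noncomm_ring
    have e2 : a - p * a * t = (1 - p) * a + w * (-(2 : ℂ) • t * (p * a)) := by
      rw [← mul_assoc, ← e1, sub_mul 1 t, ← (hpt.mul_left hat).eq]
      noncomm_ring
    rw [e2]
    refine Dec.add_orth hu (hwd.mul ?_) ?_
    · exact (hwt.smul_right _).mul_right (hpw.symm.mul_right haw.symm)
    · have hc : Commute (p * a) (w * (-(2 : ℂ) • t)) :=
        (hpw.mul_left haw).mul_right ((hpt.mul_left hat).smul_right _)
      rw [← mul_assoc w, ← hc.eq, ← mul_assoc, mul_assoc (1 - p) a, ← mul_assoc a p a, ← hpa.eq,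
        ← mul_assoc (1 - p), ← mul_assoc (1 - p), hPp]
      simp

/-- (2) implies (1). -/
lemma two_one {a e : A} (hc : ∀ y : A, y * a = a * y → e * y = y * e) (h3 : e ^ 3 = e)
    (hq : Quasinilpotent (a - e)) : ∃ b, IsGenHiranoInv a b := by
  have hea : Commute e a := hc a rfl
  have hqd := hq.dec
  obtain ⟨p, hp⟩ : ∃ p, p = e * e := ⟨_, rfl⟩
  have hpp : p * p = p := by
    have : p * p = e ^ 3 * e := by rw [hp]; noncomm_ring
    rw [this, h3, hp]
  have hpa : Commute p a := by rw [hp]; exact hea.mul_left hea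
  have e1 : a ^ 2 - p = (a - e) * (a + e) := by
    rw [hp, sub_mul, mul_add, mul_add, hea.eq]; noncomm_ring
  have hd : Dec (a ^ 2 - p) := by
    rw [e1]
    refine hqd.mul (Commute.sub_left ?_ ?_)
    · exact (Commute.refl a).add_right hea.symm
    · exact hea.add_right (Commute.refl e)
  have hqp : Commute (a ^ 2 - p) p := Commute.sub_left (hpa.symm.pow_left 2) (Commute.refl p)
  obtain ⟨s, hs⟩ : IsUnit (1 + (a ^ 2 - p) * p) := by
    simpa using (hd.mul hqp).unit_smul 1
  have has : Commute a (s : A) := by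
    rw [hs]
    exact (Commute.one_right a).add_right
      ((((Commute.refl a).pow_right 2).sub_right hpa.symm).mul_right hpa.symm)
  have hps : p * (s : A) = p * (a * a) := by
    rw [hs, mul_add, hqp.eq, ← mul_assoc, hpp, mul_sub, hpp, sq]; simp
  have hat : Commute a ((s⁻¹ : Aˣ) : A) := has.units_inv_right
  have hac : a * (p * a * ((s⁻¹ : Aˣ) : A)) = p := by
    rw [← mul_assoc, ← mul_assoc, ← hpa.eq, mul_assoc p, ← hps, mul_assoc]; simp
  have hcomm : a * (p * a * ((s⁻¹ : Aˣ) : A)) = (p * a * ((s⁻¹ : Aˣ) : A)) * a :=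
    ((hpa.symm.mul_right (Commute.refl a)).mul_right hat).eq
  refine ⟨p * a * ((s⁻¹ : Aˣ) : A), ?_, hcomm, ?_⟩
  · rw [← hcomm, hac, ← mul_assoc, ← mul_assoc, hpp]
  · rw [hac]; exact hd.quasi

end
end GH

theorem stmt7 {A : Type*} [NormedRing A] [NormedAlgebra ℂ A] [CompleteSpace A] (a : A) :
    ((∃ b, IsGenHiranoInv a b) ↔
      (∃ e : A, (∀ y : A, y * a = a * y → e * y = y * e) ∧ e ^ 3 = e ∧
        Quasinilpotent (a - e))) ∧
    ((∃ b, IsGenHiranoInv a b) ↔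
      (∃ b : A, (∀ y : A, y * a = a * y → b * y = y * b) ∧ b = (a * b) ^ 2 ∧
        Quasinilpotent (a ^ 2 - a ^ 2 * b))) := by
  refine ⟨⟨?_, ?_⟩, ⟨?_, ?_⟩⟩
  · rintro ⟨c, h⟩
    exact GH.one_two h
  · rintro ⟨e, h1, h2, h3⟩
    exact GH.two_one h1 h2 h3
  · rintro ⟨c, h⟩
    have hf := (GH.facts h).2
    obtain ⟨h1, h2, h3⟩ := h
    have hac : Commute a c := h2
    have e0 : a * (c * c) = c := by rw [← mul_assoc, h2, ← h1]
    refine ⟨c * c, fun y hy => ?_, ?_, ?_⟩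
    · exact ((hf y hy).mul_right (hf y hy)).eq.symm
    · rw [e0, sq]
    · rwa [sq a, mul_assoc, e0, ← sq]
  · rintro ⟨b, h1, h2, h3⟩
    have hba : Commute b a := h1 a rfl
    have e0 : a * (a * b) = a ^ 2 * b := by rw [sq, mul_assoc]
    refine ⟨a * b, ?_, ?_, ?_⟩
    · have : a * b * a * (a * b) = a * (a * b) ^ 2 := by
        rw [mul_assoc a b a, hba.eq, sq, mul_assoc]
      rw [this, ← h2]
    · rw [mul_assoc, hba.eq]
    · rwa [e0]
end

section
/- Let A be a complex Banach algebra with identity and let a, b, c, d ∈ A satisfy (ac)²a = (db)²a and (ac)²d = (db)²d. Then (ac)² ∈ A^{qnil} if and only if (bd)² ∈ A^{qnil}. -/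
open Filter Topology in
lemma qnil_iff_tendsto {A : Type*} [NormedRing A] [NormedAlgebra ℂ A] [CompleteSpace A] (x : A) :
    Quasinilpotent x ↔ ∀ r : ℝ, 0 < r → Tendsto (fun n : ℕ => ‖x ^ n‖ * r ^ n) atTop (𝓝 0) := by
  constructor
  · intro h r hr
    have hs : spectralRadius ℂ x = 0 := by
      unfold spectralRadius
      simp only [ENNReal.iSup_eq_zero]
      intro k hk
      by_contra hne
      have hk0 : k ≠ 0 := by
        rintro rfl
        simp at hne
      apply hk
      have h1 := h (algebraMap ℂ A (-k⁻¹)) (Algebra.commutes _ _)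
      have h2 : IsUnit (algebraMap ℂ A k) := (IsUnit.mk0 k hk0).map _
      have h3 : algebraMap ℂ A k - x
          = algebraMap ℂ A k * (1 + x * algebraMap ℂ A (-k⁻¹)) := by
        rw [← Algebra.commutes (-k⁻¹) x, mul_add, ← mul_assoc, ← map_mul, mul_neg,
          mul_inv_cancel₀ hk0]
        simp [sub_eq_add_neg]
      rw [spectrum.mem_resolventSet_iff, h3]
      exact h2.mul h1
    have ht := spectrum.pow_norm_pow_one_div_tendsto_nhds_spectralRadius x
    rw [hs] at ht
    have hpos : (0 : ENNReal) < ENNReal.ofReal (1 / (2 * r)) := by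
      rw [ENNReal.ofReal_pos]; positivity
    have hev := ht.eventually (gt_mem_nhds hpos)
    have hg : Tendsto (fun n : ℕ => (1 / 2 : ℝ) ^ n) atTop (𝓝 0) :=
      tendsto_pow_atTop_nhds_zero_of_lt_one (by norm_num) (by norm_num)
    refine squeeze_zero' (Eventually.of_forall fun n => by positivity) ?_ hg
    filter_upwards [hev, eventually_ge_atTop 1] with n hn hn1
    rw [ENNReal.ofReal_lt_ofReal_iff (by positivity)] at hn
    have h4 : ‖x ^ n‖ = (‖x ^ n‖ ^ (1 / (n : ℝ))) ^ n := by
      rw [one_div, Real.rpow_inv_natCast_pow (norm_nonneg _) (by omega)]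
    calc ‖x ^ n‖ * r ^ n = (‖x ^ n‖ ^ (1 / (n : ℝ)) * r) ^ n := by rw [mul_pow, ← h4]
      _ ≤ (1 / (2 * r) * r) ^ n := by gcongr
      _ = (1 / 2) ^ n := by congr 1; field_simp
  · intro h y hy
    have ht := h (‖y‖ + 1) (by positivity)
    obtain ⟨n, hn, hn1⟩ := ((ht.eventually (gt_mem_nhds one_pos)).and
      (eventually_ge_atTop 1)).exists
    have hc : Commute x y := hy.symm
    have hlt : ‖(-(x * y)) ^ n‖ < 1 := by
      rw [← mul_neg, (hc.neg_right).mul_pow]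
      refine lt_of_le_of_lt ?_ hn
      refine (norm_mul_le _ _).trans ?_
      gcongr
      refine (norm_pow_le' _ (by omega)).trans ?_
      rw [norm_neg]
      gcongr
      linarith
    have hu : IsUnit (1 - (-(x * y)) ^ n) := isUnit_one_sub_of_norm_lt_one hlt
    have e1 := mul_neg_geom_sum (-(x * y)) n
    have e2 := geom_sum_mul_neg (-(x * y)) n
    rw [sub_neg_eq_add] at e1 e2
    have hcm : Commute (1 + x * y) (∑ i ∈ Finset.range n, (-(x * y)) ^ i) := e1.trans e2.symm
    rw [← e1] at hu
    exact (hcm.isUnit_mul_iff.1 hu).1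

open Filter Topology in
lemma qnil_transfer {A : Type*} [NormedRing A] [NormedAlgebra ℂ A] [CompleteSpace A]
    (x y u v : A) (hxy : ∀ n : ℕ, x ^ (n + 1) = u * y ^ n * v) (hy : Quasinilpotent y) :
    Quasinilpotent x := by
  rw [qnil_iff_tendsto] at hy ⊢
  intro r hr
  rw [← tendsto_add_atTop_iff_nat 1]
  have h := (hy r hr).const_mul (‖u‖ * ‖v‖ * r)
  rw [mul_zero] at h
  refine squeeze_zero (fun n => by positivity) (fun n => ?_) h
  rw [hxy]
  calc ‖u * y ^ n * v‖ * r ^ (n + 1) ≤ (‖u‖ * ‖y ^ n‖ * ‖v‖) * r ^ (n + 1) := by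
        gcongr
        exact (norm_mul_le _ _).trans (by gcongr; exact norm_mul_le _ _)
    _ = _ := by ring

lemma pow_aux {A : Type*} [Ring A] (P Q : A) (h : P * P = Q * P) (h' : Q * Q = P * Q) (n : ℕ) :
    P ^ (n + 1) = 1 * Q ^ n * P := by
  induction n with
  | zero => simp
  | succ n ih =>
    rw [pow_succ' P, ih]
    cases n with
    | zero => simpa using h
    | succ m =>
      simp only [one_mul, pow_succ' Q]
      simp only [← mul_assoc]
      rw [← h']

lemma swap_aux {A : Type*} [Ring A] (b d : A) (n : ℕ) :
    ((b * d) ^ 2) ^ (n + 1) = b * ((d * b) ^ 2) ^ n * (d * b * d) := by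
  induction n with
  | zero => simp [sq, mul_assoc]
  | succ n ih =>
    rw [pow_succ, ih, pow_succ ((d * b) ^ 2) n]
    simp only [sq, mul_assoc]

theorem stmt8 {A : Type*} [NormedRing A] [NormedAlgebra ℂ A] [CompleteSpace A] (a b c d : A)
    (h1 : (a * c) ^ 2 * a = (d * b) ^ 2 * a) (h2 : (a * c) ^ 2 * d = (d * b) ^ 2 * d) :
    Quasinilpotent ((a * c) ^ 2) ↔ Quasinilpotent ((b * d) ^ 2) := by
  have hP : (a * c) ^ 2 * (a * c) ^ 2 = (d * b) ^ 2 * (a * c) ^ 2 := by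
    have e : (a * c) ^ 2 = a * (c * a * c) := by simp only [sq, mul_assoc]
    calc (a * c) ^ 2 * (a * c) ^ 2 = (a * c) ^ 2 * (a * (c * a * c)) := by rw [← e]
      _ = (d * b) ^ 2 * (a * (c * a * c)) := by rw [← mul_assoc, h1, mul_assoc]
      _ = _ := by rw [← e]
  have hQ : (d * b) ^ 2 * (d * b) ^ 2 = (a * c) ^ 2 * (d * b) ^ 2 := by
    have e : (d * b) ^ 2 = d * (b * d * b) := by simp only [sq, mul_assoc]
    calc (d * b) ^ 2 * (d * b) ^ 2 = (d * b) ^ 2 * (d * (b * d * b)) := by rw [← e]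
      _ = (a * c) ^ 2 * (d * (b * d * b)) := by rw [← mul_assoc, ← h2, mul_assoc]
      _ = _ := by rw [← e]
  constructor
  · intro h
    exact qnil_transfer _ _ _ _ (swap_aux b d) (qnil_transfer _ _ _ _ (pow_aux _ _ hQ hP) h)
  · intro h
    exact qnil_transfer _ _ _ _ (pow_aux _ _ hP hQ) (qnil_transfer _ _ _ _ (swap_aux d b) h)
end

section
/- Let A be a complex Banach algebra with identity and let a, b, c, d ∈ A satisfy (ac)²a = (db)²a and (ac)²d = (db)²d. Then (ac)² has a g-Drazin inverse if and only if (bd)² has a g-Drazin inverse. -/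
theorem qn_isUnit_swap {A : Type*} [Ring A] (x y : A) (h : IsUnit (1 + x * y)) :
    IsUnit (1 + y * x) := by
  obtain ⟨⟨u, v, huv, hvu⟩, hu⟩ := h
  simp only at hu
  subst hu
  refine ⟨⟨1 + y * x, 1 - y * v * x, ?_, ?_⟩, rfl⟩
  · have : (1 + y * x) * (1 - y * v * x) = 1 + y * x - y * ((1 + x * y) * v) * x := by noncomm_ring
    rw [this, huv]; noncomm_ring
  · have : (1 - y * v * x) * (1 + y * x) = 1 + y * x - y * (v * (1 + x * y)) * x := by noncomm_ring
    rw [this, hvu]; noncomm_ring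

theorem qn_isUnit_transfer {A : Type*} [Ring A] (R W : A) (h1 : R * R = W * R)
    (h2 : R * W = W * W) (h : IsUnit (1 + W)) : IsUnit (1 + R) := by
  obtain ⟨⟨u, v, huv, hvu⟩, hu⟩ := h
  simp only at hu
  subst hu
  have e1 : v = 1 - W * v := by
    have : v + W * v = 1 := by rw [← huv]; noncomm_ring
    exact eq_sub_of_add_eq this
  have e2 : R * v = R - W * W * v := by
    calc R * v = R * (1 - W * v) := by rw [← e1]
      _ = R - (R * W) * v := by noncomm_ring
      _ = _ := by rw [h2]
  refine ⟨⟨1 + R, 1 - v * R, ?_, ?_⟩, rfl⟩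
  · calc (1 + R) * (1 - v * R) = 1 + R - v * R - (R * v) * R := by noncomm_ring
      _ = 1 + R - v * R - (R * R - W * W * v * R) := by rw [e2]; noncomm_ring
      _ = 1 + R - v * R - W * (1 - W * v) * R := by rw [h1]; noncomm_ring
      _ = 1 + R - v * R - W * v * R := by rw [← e1]
      _ = 1 + R - ((1 + W) * v) * R := by noncomm_ring
      _ = 1 := by rw [huv]; noncomm_ring
  · calc (1 - v * R) * (1 + R) = 1 + R - v * R - v * (R * R) := by noncomm_ring
      _ = 1 + R - (v * (1 + W)) * R := by rw [h1]; noncomm_ring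
      _ = 1 := by rw [hvu]; noncomm_ring

open Filter Topology ENNReal in
theorem qn_iff {A : Type*} [NormedRing A] [NormedAlgebra ℂ A] [CompleteSpace A] (a : A) :
    Quasinilpotent a ↔ ∀ k : ℂ, IsUnit (1 + k • a) := by
  constructor
  · intro h k
    have := h (k • 1) (by simp)
    simpa using this
  · intro h x hx
    have h0 : spectralRadius ℂ a = 0 := by
      simp only [spectralRadius, ENNReal.iSup_eq_zero]
      intro k hk
      by_contra hne
      have hk0 : k ≠ 0 := by
        rintro rfl
        simp at hne
      apply hk
      have h3 := (h (-k⁻¹)).smul (Units.mk0 k hk0)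
      have h4 : (Units.mk0 k hk0) • (1 + (-k⁻¹) • a) = algebraMap ℂ A k - a := by
        rw [Units.smul_mk0, smul_add, smul_smul, Algebra.algebraMap_eq_smul_one]
        simp [hk0, sub_eq_add_neg]
      rw [h4] at h3
      exact h3
    have hxt : spectralRadius ℂ x ≠ ⊤ := by
      refine ne_top_of_le_ne_top ?_ (spectrum.spectralRadius_le_pow_nnnorm_pow_one_div ℂ x 0)
      simp [ENNReal.mul_eq_top]
    have ta := spectrum.pow_nnnorm_pow_one_div_tendsto_nhds_spectralRadius a
    have tx := spectrum.pow_nnnorm_pow_one_div_tendsto_nhds_spectralRadius x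
    have tax := spectrum.pow_nnnorm_pow_one_div_tendsto_nhds_spectralRadius (a * x)
    have tm := ENNReal.Tendsto.mul ta (Or.inr hxt) tx
      (Or.inr (by rw [h0]; simp))
    have hle : spectralRadius ℂ (a * x) ≤ spectralRadius ℂ a * spectralRadius ℂ x := by
      refine le_of_tendsto_of_tendsto' tax tm fun n => ?_
      rw [← ENNReal.mul_rpow_of_nonneg _ _ (by positivity)]
      refine ENNReal.rpow_le_rpow ?_ (by positivity)
      have hc : Commute a x := hx.symm
      rw [hc.mul_pow]
      exact_mod_cast nnnorm_mul_le _ _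
    rw [h0, zero_mul] at hle
    have hm : (-1 : ℂ) ∈ resolventSet ℂ (a * x) := by
      apply spectrum.mem_resolventSet_of_spectralRadius_lt
      refine lt_of_le_of_lt hle ?_
      simp
    rw [spectrum.mem_resolventSet_iff] at hm
    have := hm.neg
    simpa [add_comm] using this

theorem gd_cline {A : Type*} [NormedRing A] [NormedAlgebra ℂ A] [CompleteSpace A] (x y : A)
    (h : ∃ z, IsGDrazinInv (x * y) z) : ∃ z, IsGDrazinInv (y * x) z := by
  obtain ⟨z, hz1, hz2, hz3⟩ := h
  obtain ⟨p, hp⟩ : ∃ p, p = x * y := ⟨_, rfl⟩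
  rw [← hp] at hz1 hz2 hz3
  have hzz : z * z * p = z := by rw [mul_assoc, ← hz2, ← mul_assoc, ← hz1]
  have hpz : p * (z * z) = z := by rw [← mul_assoc, hz2, ← hz1]
  have e1 : y * x * (y * (z * z) * x) = y * z * x := by
    calc _ = y * ((x * y) * (z * z)) * x := by noncomm_ring
      _ = _ := by rw [← hp, hpz]
  have e2 : (y * (z * z) * x) * (y * x) = y * z * x := by
    calc _ = y * ((z * z) * (x * y)) * x := by noncomm_ring
      _ = _ := by rw [← hp, hzz]
  refine ⟨y * (z * z) * x, ?_, e1.trans e2.symm, ?_⟩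
  · rw [e2]
    calc y * (z * z) * x = y * (z * (p * (z * z))) * x := by rw [hpz]
      _ = _ := by rw [hp]; noncomm_ring
  · rw [qn_iff] at hz3 ⊢
    intro k
    have e3 : y * x - (y * x) ^ 2 * (y * (z * z) * x) = y * ((1 - p * z) * x) := by
      rw [pow_two, mul_assoc (y * x), e1, hp]; noncomm_ring
    have e4 : p - p ^ 2 * z = ((1 - p * z) * x) * y := by
      have : ((1 - p * z) * x) * y = (1 - p * z) * p := by rw [mul_assoc, ← hp]
      rw [this, sub_mul, mul_assoc, ← hz2, one_mul, pow_two, mul_assoc]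
    have := hz3 k
    rw [e4, ← mul_smul_comm] at this
    have := qn_isUnit_swap _ _ this
    rw [e3]
    simpa using this

theorem gd_transfer {A : Type*} [NormedRing A] [NormedAlgebra ℂ A] [CompleteSpace A] (P Q : A)
    (hP : Q * P = P * P) (hQ : P * Q = Q * Q)
    (h : ∃ z, IsGDrazinInv P z) : ∃ z, IsGDrazinInv Q z := by
  obtain ⟨x, hx1, hx2, hx3⟩ := h
  have hxx : x * x * P = x := by rw [mul_assoc, ← hx2, ← mul_assoc, ← hx1]
  have hpx : P * (x * x) = x := by rw [← mul_assoc, hx2, ← hx1]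
  have hQx : Q * x = P * x := by
    calc Q * x = Q * (P * (x * x)) := by rw [hpx]
      _ = (Q * P) * (x * x) := by noncomm_ring
      _ = P * (P * (x * x)) := by rw [hP]; noncomm_ring
      _ = _ := by rw [hpx]
  have e1 : Q * (x * x * Q) = x * Q := by
    calc _ = (Q * x) * (x * Q) := by noncomm_ring
      _ = (P * (x * x)) * Q := by rw [hQx]; noncomm_ring
      _ = _ := by rw [hpx]
  have e2 : (x * x * Q) * Q = x * Q := by
    calc _ = x * x * (Q * Q) := by noncomm_ring
      _ = x * x * P * Q := by rw [← hQ]; noncomm_ring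
      _ = _ := by rw [hxx]
  refine ⟨x * x * Q, ?_, e1.trans e2.symm, ?_⟩
  · rw [e2]
    calc x * x * Q = x * (P * (x * x)) * Q := by rw [hpx]
      _ = x * (P * x) * (x * Q) := by noncomm_ring
      _ = x * (Q * x) * (x * Q) := by rw [hQx]
      _ = _ := by noncomm_ring
  · rw [qn_iff] at hx3 ⊢
    intro k
    have e3 : Q - Q ^ 2 * (x * x * Q) = Q - P * x * Q := by
      rw [pow_two, mul_assoc Q, e1, ← mul_assoc, hQx]
    rw [e3]
    have e4 : P * x * P = P * P * x := by rw [mul_assoc, ← hx2, mul_assoc]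
    have e5 : P * x * (P * x) = P * x := by rw [mul_assoc, ← mul_assoc x, ← hx1]
    have hRR : (Q - P * x * Q) * (Q - P * x * Q) = (P - P ^ 2 * x) * (Q - P * x * Q) := by
      have a1 : Q * (Q - P * x * Q) = P * Q - P * P * x * Q := by
        calc _ = Q * Q - (Q * P) * x * Q := by noncomm_ring
          _ = _ := by rw [hP, ← hQ]
      have a2 : P * (Q - P * x * Q) = P * Q - P * P * x * Q := by noncomm_ring
      calc _ = Q * (Q - P * x * Q) - P * x * (Q * (Q - P * x * Q)) := by noncomm_ring
        _ = P * (Q - P * x * Q) - P * x * (P * (Q - P * x * Q)) := by rw [a1, a2]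
        _ = P * (Q - P * x * Q) - (P * x * P) * (Q - P * x * Q) := by noncomm_ring
        _ = _ := by rw [e4]; noncomm_ring
    have hRW : (Q - P * x * Q) * (P - P ^ 2 * x) = (P - P ^ 2 * x) * (P - P ^ 2 * x) := by
      have b : Q * (P - P ^ 2 * x) = P * (P - P ^ 2 * x) := by
        calc _ = Q * P - (Q * P) * P * x := by noncomm_ring
          _ = _ := by rw [hP]; noncomm_ring
      calc _ = Q * (P - P ^ 2 * x) - P * x * (Q * (P - P ^ 2 * x)) := by noncomm_ring
        _ = P * (P - P ^ 2 * x) - (P * x * P) * (P - P ^ 2 * x) := by rw [b]; noncomm_ring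
        _ = _ := by rw [e4]; noncomm_ring
    refine qn_isUnit_transfer _ (k • (P - P ^ 2 * x)) ?_ ?_ (hx3 k)
    · rw [smul_mul_smul_comm, smul_mul_smul_comm, hRR]
    · rw [smul_mul_smul_comm, smul_mul_smul_comm, hRW]

theorem stmt9 {A : Type*} [NormedRing A] [NormedAlgebra ℂ A] [CompleteSpace A] (a b c d : A)
    (h1 : (a * c) ^ 2 * a = (d * b) ^ 2 * a) (h2 : (a * c) ^ 2 * d = (d * b) ^ 2 * d) :
    (∃ x, IsGDrazinInv ((a * c) ^ 2) x) ↔ (∃ x, IsGDrazinInv ((b * d) ^ 2) x) := by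
  have hP : (d * b) ^ 2 * (a * c) ^ 2 = (a * c) ^ 2 * (a * c) ^ 2 := by
    calc _ = ((d * b) ^ 2 * a) * (c * a * c) := by noncomm_ring
      _ = _ := by rw [← h1]; noncomm_ring
  have hQ : (a * c) ^ 2 * (d * b) ^ 2 = (d * b) ^ 2 * (d * b) ^ 2 := by
    calc _ = ((a * c) ^ 2 * d) * (b * d * b) := by noncomm_ring
      _ = _ := by rw [h2]; noncomm_ring
  have e1 : (d * b) ^ 2 = d * (b * d * b) := by noncomm_ring
  have e2 : (b * d) ^ 2 = (b * d * b) * d := by noncomm_ring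
  constructor
  · intro h
    have := gd_transfer _ _ hP hQ h
    rw [e1] at this
    rw [e2]
    exact gd_cline _ _ this
  · intro h
    rw [e2] at h
    have := gd_cline _ _ h
    rw [← e1] at this
    exact gd_transfer _ _ hQ hP this
end

section
/- Let A be a complex Banach algebra with identity and let a, b, c, d ∈ A satisfy (ac)²a = (db)²a and (ac)²d = (db)²d. Then ac has a generalized Hirano inverse if and only if bd has a generalized Hirano inverse. -/
section Helpers
open Filter Topology

/-- spectrum contained in `{0}` -/
def SpZero {A : Type*} [NormedRing A] [NormedAlgebra ℂ A] (w : A) : Prop :=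
  ∀ z : ℂ, z ≠ 0 → IsUnit (z • (1 : A) - w)

/-- spectrum contained in `{0,1}` -/
def SpZeroOne {A : Type*} [NormedRing A] [NormedAlgebra ℂ A] (w : A) : Prop :=
  ∀ z : ℂ, z ≠ 0 → z ≠ 1 → IsUnit (z • (1 : A) - w)

variable {A : Type*} [NormedRing A] [NormedAlgebra ℂ A]

lemma isUnit_smul_one {z : ℂ} (hz : z ≠ 0) : IsUnit (z • (1 : A)) := by
  rw [← Algebra.algebraMap_eq_smul_one]
  exact (IsUnit.mk0 z hz).map (algebraMap ℂ A)

lemma isUnit_smul' {z : ℂ} (hz : z ≠ 0) {u : A} (hu : IsUnit u) : IsUnit (z • u) := by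
  have := (isUnit_smul_one (A := A) hz).mul hu
  simpa using this

lemma qnil_spZero {w y : A} (hw : Quasinilpotent w) (hy : y * w = w * y) : SpZero (w * y) := by
  intro z hz
  have h := hw ((-z⁻¹) • y) (by simp [hy])
  have h2 := isUnit_smul' hz h
  convert h2 using 1
  simp [smul_add, smul_smul, hz, sub_eq_add_neg]

lemma spZero_norm [CompleteSpace A] {w : A} (hw : SpZero w) {ε : ℝ} (hε : 0 < ε) :
    ∀ᶠ n : ℕ in atTop, ‖w ^ n‖ ≤ ε ^ n := by
  have h0 : spectralRadius ℂ w = 0 := by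
    unfold spectralRadius
    simp only [ENNReal.iSup_eq_zero]
    intro k hk
    by_contra hne
    have hk0 : k ≠ 0 := by rintro rfl; simp at hne
    apply hk
    have := hw k hk0
    rwa [← Algebra.algebraMap_eq_smul_one] at this
  have h := spectrum.pow_norm_pow_one_div_tendsto_nhds_spectralRadius w
  rw [h0] at h
  have h2 := h.eventually_lt_const (u := ENNReal.ofReal ε) (by simpa using hε)
  filter_upwards [h2, eventually_gt_atTop 0] with n hn hn0
  rw [ENNReal.ofReal_lt_ofReal_iff hε] at hn
  have h3 := pow_le_pow_left₀ (by positivity) hn.le n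
  rwa [← Real.rpow_natCast, ← Real.rpow_mul (norm_nonneg _), one_div,
    inv_mul_cancel₀ (by positivity), Real.rpow_one] at h3

lemma spZero_qnil [CompleteSpace A] {w : A} (hw : SpZero w) : Quasinilpotent w := by
  intro x hx
  have hc : Commute w (-x) := by
    show w * (-x) = -x * w
    simp [hx]
  have h1 := spZero_norm hw (ε := 1 / (2 * (‖x‖ + 1))) (by positivity)
  obtain ⟨n, hn, hn0⟩ := (h1.and (eventually_gt_atTop 0)).exists
  have h2 : ‖(w * (-x)) ^ n‖ < 1 := by
    rw [hc.mul_pow]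
    calc ‖w ^ n * (-x) ^ n‖ ≤ ‖w ^ n‖ * ‖(-x) ^ n‖ := norm_mul_le _ _
      _ ≤ (1 / (2 * (‖x‖ + 1))) ^ n * (‖x‖ + 1) ^ n := by
          gcongr
          refine (norm_pow_le' _ hn0).trans ?_
          rw [norm_neg]
          gcongr
          linarith
      _ = (1 / 2) ^ n := by
          rw [← mul_pow]; congr 1; field_simp
      _ < 1 := pow_lt_one₀ (by norm_num) (by norm_num) hn0.ne'
  have h3 : IsUnit (1 - (w * (-x)) ^ n) := isUnit_one_sub_of_norm_lt_one h2
  rw [← mul_neg_geom_sum] at h3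
  have h4 : Commute (1 - w * (-x)) (∑ i ∈ Finset.range n, (w * (-x)) ^ i) := by
    show _ = _
    rw [mul_neg_geom_sum, geom_sum_mul_neg]
  have := (h4.isUnit_mul_iff.mp h3).1
  simpa using this

lemma catalan_solution [CompleteSpace A] {w : A} (hw : SpZero w) :
    ∃ c : A, c = 1 + w * (c * c) ∧ ∀ x, Commute x w → Commute x c := by
  set f : ℕ → A := fun n => (catalan n : A) * w ^ n with hf
  have hcat : ∀ n, ‖f n‖ ≤ 4 ^ n * ‖w ^ n‖ := by
    intro n
    have : f n = catalan n • w ^ n := by simp [hf]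
    rw [this]
    refine (norm_nsmul_le).trans ?_
    gcongr
    have : catalan n ≤ 4 ^ n := by
      rw [catalan_eq_centralBinom_div]
      exact (Nat.div_le_self _ _).trans (Nat.centralBinom_le_four_pow n)
    exact_mod_cast this
  have hs : Summable fun n => ‖f n‖ := by
    refine Summable.of_norm_bounded_eventually_nat (g := fun n : ℕ => (1 / 2 : ℝ) ^ n)
      summable_geometric_two ?_
    filter_upwards [spZero_norm hw (ε := 1 / 8) (by norm_num)] with n hn
    rw [norm_norm]
    calc ‖f n‖ ≤ 4 ^ n * ‖w ^ n‖ := hcat n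
      _ ≤ 4 ^ n * (1 / 8) ^ n := by gcongr
      _ = (1 / 2) ^ n := by rw [← mul_pow]; norm_num
  refine ⟨∑' n, f n, ?_, ?_⟩
  · rw [tsum_mul_tsum_eq_tsum_sum_antidiagonal_of_summable_norm hs hs,
      ← Summable.tsum_mul_left _ (summable_norm_sum_mul_antidiagonal_of_summable_norm hs hs).of_norm,
      hs.of_norm.tsum_eq_zero_add]
    congr 1
    · simp [hf]
    · congr 1
      ext n
      simp only [hf]
      rw [catalan_succ', Nat.cast_sum, Finset.sum_mul, Finset.mul_sum]
      refine Finset.sum_congr rfl fun ij hij => ?_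
      rw [← Finset.HasAntidiagonal.mem_antidiagonal.mp hij, pow_succ', pow_add, Nat.cast_mul]
      have e1 : ∀ (k : ℕ) (y : A), y * (k : A) = (k : A) * y := fun k y => (Nat.cast_commute k y).symm
      have e2 : w ^ ij.1 * ((catalan ij.2 : A) * w ^ ij.2)
          = (catalan ij.2 : A) * (w ^ ij.1 * w ^ ij.2) := by
        rw [← mul_assoc, e1, mul_assoc]
      have e3 : w * ((catalan ij.1 : A) * ((catalan ij.2 : A) * (w ^ ij.1 * w ^ ij.2)))
         = (catalan ij.1 : A) * ((catalan ij.2 : A) * (w * (w ^ ij.1 * w ^ ij.2))) := by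
        rw [← mul_assoc, e1, mul_assoc, ← mul_assoc w, e1 _ w, mul_assoc]
      rw [mul_assoc (catalan ij.1 : A) (w ^ ij.1), e2, e3]
      simp only [mul_assoc]
  · intro x hx
    exact Commute.tsum_right _ fun n => (Nat.commute_cast x _).mul_right (hx.pow_right n)

lemma spZeroOne_spZero {s : A} (hs : SpZeroOne s) : SpZero (s - s * s) := by
  intro l hl
  obtain ⟨z, hz⟩ := IsAlgClosed.exists_pow_nat_eq (1 - 4 * l) (n := 2) (by norm_num)
  set m : ℂ := (1 + z) / 2 with hm
  have hml : m * (1 - m) = l := by rw [hm]; linear_combination (-1/4 : ℂ) * hz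
  have hm0 : m ≠ 0 := by rintro h; rw [h] at hml; simp at hml; exact hl hml.symm
  have hm1 : m ≠ 1 := by rintro h; rw [h] at hml; simp at hml; exact hl hml.symm
  have h1 := hs m hm0 hm1
  have h2 := hs (1 - m) (sub_ne_zero.mpr hm1.symm) (by intro h; apply hm0; linear_combination -h)
  have h3 := h1.mul h2
  convert h3 using 1
  rw [← hml]
  simp only [sub_mul, mul_sub, smul_mul_assoc, mul_smul_comm, one_mul, mul_one, smul_smul,
    sub_smul, smul_sub, one_smul]
  abel

lemma exists_idem_lift [CompleteSpace A] {s : A} (hs : SpZeroOne s) :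
    ∃ p : A, p * p = p ∧ (∀ x, Commute x s → Commute x p) ∧ Quasinilpotent (s - p) := by
  have hw := spZeroOne_spZero hs
  have hq := spZero_qnil hw
  obtain ⟨c, hc, hcc⟩ := catalan_solution hw
  set w := s - s * s with hwdef
  have hsw : ∀ x, Commute x s → Commute x w := fun x hx => hx.sub_right (hx.mul_right hx)
  have hsc : ∀ x, Commute x s → Commute x c := fun x hx => hcc x (hsw x hx)
  have hwc : Commute w c := hcc w (Commute.refl w)
  set q := w * c with hqdef
  have hsq : ∀ x, Commute x s → Commute x q := fun x hx => (hsw x hx).mul_right (hsc x hx)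
  have hqq : q = w + q * q := by
    have : q * q = w * (w * (c * c)) := by
      rw [hqdef, mul_assoc, ← mul_assoc c, ← hwc.eq, mul_assoc]
    rw [this, ← mul_one_add (α := A) , ← hc]
  have hu : IsUnit (1 - 2 * q) := by
    have := hq (-2 * c) (by
      have : Commute w (-2 * c) := ((Nat.commute_cast w 2).neg_right).mul_right hwc
      exact this.symm.eq)
    convert this using 1
    rw [hqdef]; noncomm_ring
  obtain ⟨u, hu⟩ := hu
  have hsu : ∀ x, Commute x s → Commute x (u : A) := fun x hx => by
    rw [hu]
    exact (Commute.one_right x).sub_right ((Nat.commute_cast x 2).mul_right (hsq x hx))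
  have hsv : ∀ x, Commute x s → Commute x (↑u⁻¹ : A) := fun x hx => (hsu x hx).units_inv_right
  have hss := Commute.refl s
  have hqs : Commute s q := hsq s hss
  have huv : (u : A) * ↑u⁻¹ = 1 := u.mul_inv
  have hqv : Commute q (↑u⁻¹ : A) := hsv q hqs.symm
  have hsv' : Commute s (↑u⁻¹ : A) := hsv s hss
  set v : A := ↑u⁻¹ with hv
  have key : (s - q) * (s - q) = (s - q) * u := by
    have h1 : q * q = q - s + s * s := by
      have := hqq
      rw [hwdef] at this
      have h3 : q * q = q - (s - s * s) := eq_sub_of_add_eq' this.symm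
      rw [h3]; abel
    rw [hu]
    have h2 : (s - q) * (s - q) - (s - q) * (1 - 2 * q) = s * s + s * q - q * s - s + q - q * q := by
      noncomm_ring
    rw [← sub_eq_zero, h2, h1, hqs.eq]
    noncomm_ring
  refine ⟨(s - q) * v, ?_, ?_, ?_⟩
  · have hcm : Commute (s - q) v := hsv'.sub_left hqv
    rw [mul_assoc, ← mul_assoc v, ← hcm.eq, mul_assoc, ← mul_assoc, key, mul_assoc, ← mul_assoc (u : A), huv, one_mul]
  · intro x hx
    exact (hx.sub_right (hsq x hx)).mul_right (hsv x hx)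
  · have e : s - (s - q) * v = w * (c * (1 - 2 * s) * v) := by
      have h1 : s = s * u * v := by rw [mul_assoc, huv, mul_one]
      have h2 : s * u - (s - q) = w * (c * (1 - 2 * s)) := by
        rw [← mul_assoc w, ← hqdef, hu]
        have : (2 : A) * q = q * 2 := (Nat.cast_commute 2 q)
        calc s * (1 - 2 * q) - (s - q) = q - (s * q + s * q) := by noncomm_ring
          _ = q * (1 - 2 * s) := by rw [hqs.eq]; noncomm_ring
      conv_lhs => lhs; rw [h1]
      rw [← sub_mul, h2]; simp only [mul_assoc]
    rw [e]
    apply spZero_qnil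
    apply qnil_spZero hq
    have hws : Commute w s := (hsw s hss).symm
    have : Commute w (c * (1 - 2 * s) * v) :=
      (hwc.mul_right ((Commute.one_right w).sub_right ((Nat.commute_cast w 2).mul_right hws))).mul_right
        (hsv w hws)
    exact this.symm.eq

lemma hirano_iff [CompleteSpace A] (a : A) :
    (∃ x, IsGenHiranoInv a x) ↔ SpZeroOne (a ^ 2) := by
  constructor
  · rintro ⟨b, hb, hab, hq⟩ z hz0 hz1
    have hcab : Commute a b := hab
    set p := a * b with hp
    have hpp : p * p = p := by
      rw [hp, mul_assoc, ← mul_assoc b, ← hb]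
    have hap : Commute a p := (Commute.refl a).mul_right hcab
    set k := a ^ 2 - p with hk
    have hpk : Commute p k := (hap.symm.pow_right 2).sub_right (Commute.refl p)
    -- inverse of `z - p`
    have hz1' : z - 1 ≠ 0 := sub_ne_zero.mpr hz1
    set y : A := z⁻¹ • (1 - p) + (z - 1)⁻¹ • p with hy
    have hky : Commute k y :=
      (((Commute.one_right k).sub_right hpk.symm).smul_right _).add_right (hpk.symm.smul_right _)
    have hzy : (z • (1 : A) - p) * y = 1 := by
      have e1 : (z • (1 : A) - p) * (1 - p) = z • (1 - p) := by
        simp [sub_mul, mul_sub, hpp, smul_sub]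
      have e2 : (z • (1 : A) - p) * p = (z - 1) • p := by
        simp [sub_mul, hpp, sub_smul]
      rw [hy, mul_add, mul_smul_comm, mul_smul_comm, e1, e2, smul_smul, smul_smul,
        inv_mul_cancel₀ hz0, inv_mul_cancel₀ hz1']
      simp
    have hcy : Commute (z • (1 : A) - p) y := by
      have hpy : Commute p y :=
        (((Commute.one_right p).sub_right (Commute.refl p)).smul_right _).add_right
          ((Commute.refl p).smul_right _)
      exact ((Commute.one_left y).smul_left z).sub_left hpy
    have hun : IsUnit (z • (1 : A) - p) :=
      (hcy.isUnit_mul_iff.mp (by rw [hzy]; exact isUnit_one)).1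
    have hfin := hun.mul (hq (-y) (by simp [hky.eq]))
    convert hfin using 1
    have hck : Commute k (z • (1 : A) - p) :=
      ((Commute.one_right k).smul_right z).sub_right hpk.symm
    rw [mul_add, mul_one, ← mul_assoc, ← hck.eq, mul_assoc, mul_neg, hzy, hk]
    noncomm_ring
  · intro h
    obtain ⟨p, hpp, hpc, hq⟩ := exists_idem_lift h
    have hap : Commute a p := hpc a ((Commute.refl a).pow_right 2)
    obtain ⟨u, hu⟩ := hq 1 (by simp)
    rw [mul_one] at hu
    have hau : Commute a (u : A) := by
      rw [hu]
      exact (Commute.one_right a).add_right (((Commute.refl a).pow_right 2).sub_right hap)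
    have hpu : Commute p (u : A) := by
      rw [hu]
      exact (Commute.one_right p).add_right ((hap.symm.pow_right 2).sub_right (Commute.refl p))
    have hav := hau.units_inv_right
    have hpv := hpu.units_inv_right
    have huv : (u : A) * ↑u⁻¹ = 1 := u.mul_inv
    set v : A := ↑u⁻¹ with hv
    have h1 : a ^ 2 * p = p * u := by
      rw [hu, mul_add, mul_sub, hpp, (hap.pow_left 2).eq]; simp
    have hab : a * (a * p * v) = p := by
      rw [← mul_assoc, ← mul_assoc, ← sq, h1, mul_assoc, huv, mul_one]
    have hcomm : Commute a (a * p * v) := ((Commute.refl a).mul_right hap).mul_right hav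
    refine ⟨a * p * v, ?_, hcomm.eq, ?_⟩
    · rw [← hcomm.eq, hab]
      rw [← mul_assoc, ← mul_assoc, ← hap.eq, mul_assoc a p p, hpp]
    · rw [hab]; exact hq

lemma spZeroOne_swap {x y : A} (h : SpZeroOne (x * y)) : SpZeroOne (y * x) := by
  intro z hz0 hz1
  have h1 := h z hz0 hz1
  by_contra hn
  have hm : z ∈ spectrum ℂ (y * x) \ {0} := by
    refine ⟨?_, hz0⟩
    rw [spectrum.mem_iff, Algebra.algebraMap_eq_smul_one]
    exact hn
  rw [spectrum.nonzero_mul_comm] at hm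
  have := hm.1
  rw [spectrum.mem_iff, Algebra.algebraMap_eq_smul_one] at this
  exact this h1

lemma spZeroOne_perturb {s r : A} (hs : SpZeroOne s) (h1 : r * s = 0) (h2 : r * r = 0) :
    SpZeroOne (s + r) := by
  intro z hz0 hz1
  have hu : IsUnit (1 - z⁻¹ • r) := by
    have : IsUnit ((1 - z⁻¹ • r) * (1 + z⁻¹ • r)) := by
      have e : (1 - z⁻¹ • r) * (1 + z⁻¹ • r) = 1 := by
        simp [sub_mul, mul_add, h2]
      rw [e]; exact isUnit_one
    refine (Commute.isUnit_mul_iff ?_).mp this |>.1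
    exact ((Commute.one_right _).add_right (((Commute.one_left r).sub_left
      ((Commute.refl r).smul_left _)).smul_right _))
  convert hu.mul (hs z hz0 hz1) using 1
  have e : z • (z⁻¹ • r) = r := by rw [smul_smul, mul_inv_cancel₀ hz0, one_smul]
  simp only [sub_mul, mul_sub, one_mul, smul_mul_assoc, mul_smul_comm, mul_one, h1, smul_zero,
    smul_sub, e]
  abel

end Helpers

theorem stmt10 {A : Type*} [NormedRing A] [NormedAlgebra ℂ A] [CompleteSpace A] (a b c d : A)
    (h1 : (a * c) ^ 2 * a = (d * b) ^ 2 * a) (h2 : (a * c) ^ 2 * d = (d * b) ^ 2 * d) :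
    (∃ x, IsGenHiranoInv (a * c) x) ↔ (∃ x, IsGenHiranoInv (b * d) x) := by
  rw [hirano_iff, hirano_iff]
  set t := (a * c) ^ 2 - (d * b) ^ 2 with ht
  have ta : t * a = 0 := by rw [ht, sub_mul, h1, sub_self]
  have td : t * d = 0 := by rw [ht, sub_mul, h2, sub_self]
  have tac : t * (a * c) ^ 2 = 0 := by
    rw [sq, ← mul_assoc, ← mul_assoc t, ta]; simp
  have tdb : t * (d * b) ^ 2 = 0 := by
    rw [sq, ← mul_assoc, ← mul_assoc t, td]; simp
  have tt : t * t = 0 := by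
    nth_rewrite 2 [ht]
    rw [mul_sub, tac, tdb, sub_zero]
  have e1 : (d * b) ^ 2 = (d * b * d) * b := by rw [sq]; simp only [mul_assoc]
  have e2 : (b * d) ^ 2 = b * (d * b * d) := by rw [sq]; simp only [mul_assoc]
  have hswap : SpZeroOne ((d * b) ^ 2) ↔ SpZeroOne ((b * d) ^ 2) := by
    rw [e1, e2]; exact ⟨spZeroOne_swap, spZeroOne_swap⟩
  rw [← hswap]
  constructor
  · intro h
    have := spZeroOne_perturb h (r := -t) (by simp [tac]) (by simp [tt])
    simpa [ht] using this
  · intro h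
    have := spZeroOne_perturb h (r := t) tdb tt
    simpa [ht] using this
end

section
/- Let A be a complex Banach algebra with identity and let a, b, c, d ∈ A satisfy aca = dba and dbd = acd. Then (ac)² ∈ A^{qnil} if and only if (bd)² ∈ A^{qnil}. -/
theorem qn_decay {A : Type*} [NormedRing A] [NormedAlgebra ℂ A] [CompleteSpace A] (u : A)
    (hu : Quasinilpotent u) (e : ℝ) (he : 0 < e) :
    ∀ᶠ n : ℕ in Filter.atTop, ‖u ^ n‖ ≤ e ^ n := by
  have hr : spectralRadius ℂ u = 0 := by
    unfold spectralRadius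
    simp only [ENNReal.iSup_eq_zero]
    intro k hk
    by_contra hk0
    have hk0 : k ≠ 0 := by rintro rfl; simp at hk0
    apply hk
    change IsUnit (algebraMap ℂ A k - u)
    have h := hu (algebraMap ℂ A (-k⁻¹)) (Algebra.commutes _ _)
    have h2 := ((IsUnit.mk0 k hk0).map (algebraMap ℂ A)).mul h
    convert h2 using 1
    rw [← Algebra.commutes, mul_add, mul_one, ← mul_assoc, ← map_mul]
    simp [hk0, sub_eq_add_neg]
  have ht := spectrum.pow_norm_pow_one_div_tendsto_nhds_spectralRadius u
  rw [hr] at ht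
  have h := ht.eventually (gt_mem_nhds (ENNReal.ofReal_pos.2 he))
  filter_upwards [h, Filter.eventually_gt_atTop 0] with n hn hn0
  have h3 := (ENNReal.ofReal_lt_ofReal_iff he).1 hn
  have h4 := pow_le_pow_left₀ (by positivity) h3.le n
  rwa [one_div, Real.rpow_inv_natCast_pow (norm_nonneg _) hn0.ne'] at h4

theorem qn_transfer {A : Type*} [NormedRing A] [NormedAlgebra ℂ A] [CompleteSpace A] (u v p q : A)
    (h : ∀ n : ℕ, v ^ (n + 1) = p * u ^ n * q)
    (hu : Quasinilpotent u) : Quasinilpotent v := by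
  intro x hx
  set R := ‖x‖ + 1 with hR
  have hR0 : 0 < R := by positivity
  have key : ∃ n : ℕ, ‖(-(v * x)) ^ (n + 1)‖ < 1 := by
    have hd := qn_decay u hu ((2 * R)⁻¹) (by positivity)
    have ht : Filter.Tendsto (fun n : ℕ => (‖p‖ * ‖q‖ * R) * (1 / 2 : ℝ) ^ n) Filter.atTop
        (nhds ((‖p‖ * ‖q‖ * R) * 0)) :=
      (tendsto_pow_atTop_nhds_zero_of_lt_one (by norm_num) (by norm_num)).const_mul _
    rw [mul_zero] at ht
    obtain ⟨n, hn, hn2⟩ := (hd.and (ht.eventually (gt_mem_nhds one_pos))).exists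
    refine ⟨n, lt_of_le_of_lt ?_ hn2⟩
    have e1 : ‖(-(v * x)) ^ (n + 1)‖ = ‖p * u ^ n * q * x ^ (n + 1)‖ := by
      rw [← h n, neg_pow, (show Commute v x from hx.symm).mul_pow]
      rcases neg_one_pow_eq_or A (n + 1) with h | h <;> simp [h]
    have e2 : ‖x ^ (n + 1)‖ ≤ R ^ (n + 1) :=
      (norm_pow_le' x n.succ_pos).trans (pow_le_pow_left₀ (norm_nonneg _) (by simp [hR]) _)
    rw [e1]
    calc ‖p * u ^ n * q * x ^ (n + 1)‖ ≤ ‖p‖ * ‖u ^ n‖ * ‖q‖ * ‖x ^ (n + 1)‖ := by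
          refine (norm_mul_le _ _).trans ?_
          gcongr
          refine (norm_mul_le _ _).trans ?_
          gcongr
          exact norm_mul_le _ _
      _ ≤ ‖p‖ * (2 * R)⁻¹ ^ n * ‖q‖ * R ^ (n + 1) := by gcongr
      _ = _ := by
          rw [inv_pow, mul_pow, one_div, inv_pow]
          field_simp
          ring
  obtain ⟨n, hn⟩ := key
  have hun := isUnit_one_sub_of_norm_lt_one hn
  rw [← mul_neg_geom_sum] at hun
  have hc : Commute (1 - -(v * x)) (∑ i ∈ Finset.range (n + 1), (-(v * x)) ^ i) := by
    rw [Commute, SemiconjBy, mul_neg_geom_sum, geom_sum_mul_neg]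
  have := (hc.isUnit_mul_iff.1 hun).1
  rwa [sub_neg_eq_add] at this

theorem stmt11 {A : Type*} [NormedRing A] [NormedAlgebra ℂ A] [CompleteSpace A] (a b c d : A)
    (h1 : a * c * a = d * b * a) (h2 : d * b * d = a * c * d) :
    Quasinilpotent ((a * c) ^ 2) ↔ Quasinilpotent ((b * d) ^ 2) := by
  have s1 : (b * d) ^ 2 = b * (a * c * d) := by rw [← h2]; simp only [pow_two, mul_assoc]
  have s2 : (a * c) ^ 2 = d * (b * a * c) := by
    rw [pow_two, ← mul_assoc, h1]; simp only [pow_two, mul_assoc]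
  have t1 : a * c * d * (b * d) ^ 2 = (a * c) ^ 2 * (a * c * d) := by
    calc a * c * d * (b * d) ^ 2 = a * c * (d * b * d) * b * d := by simp only [pow_two, mul_assoc]
      _ = a * c * (a * c * d) * b * d := by rw [h2]
      _ = a * c * a * c * (d * b * d) := by simp only [pow_two, mul_assoc]
      _ = _ := by rw [h2]; simp only [pow_two, mul_assoc]
  have t2 : b * a * c * (a * c) ^ 2 = (b * d) ^ 2 * (b * a * c) := by
    calc b * a * c * (a * c) ^ 2 = b * (a * c * a) * c * a * c := by simp only [pow_two, mul_assoc]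
      _ = b * (d * b * a) * c * a * c := by rw [h1]
      _ = b * d * b * (a * c * a) * c := by simp only [pow_two, mul_assoc]
      _ = _ := by rw [h1]; simp only [pow_two, mul_assoc]
  constructor
  · refine qn_transfer _ _ b (a * c * d) fun n => ?_
    rw [mul_assoc b, ← (show SemiconjBy (a * c * d) ((b * d) ^ 2) ((a * c) ^ 2) from t1).pow_right n,
      ← mul_assoc b, ← s1, ← pow_succ']
  · refine qn_transfer _ _ d (b * a * c) fun n => ?_
    rw [mul_assoc d, ← (show SemiconjBy (b * a * c) ((a * c) ^ 2) ((b * d) ^ 2) from t2).pow_right n,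
      ← mul_assoc d, ← s2, ← pow_succ']
end

section
/- Let A be a complex Banach algebra with identity and let a, b, c, d ∈ A satisfy acac = dbdb. Then ac has a generalized Hirano inverse if and only if bd has a generalized Hirano inverse. -/
lemma isUnit_swap_aux {A : Type*} [Ring A] {x y : A} (hu : IsUnit (1 - x * y)) :
    IsUnit (1 - y * x) := by
  obtain ⟨v, h1, h2⟩ := isUnit_iff_exists.mp hu
  refine isUnit_iff_exists.mpr ⟨1 + y * v * x, ?_, ?_⟩
  · have : (1 - y * x) * (1 + y * v * x) = 1 - y * x + y * ((1 - x * y) * v) * x := by noncomm_ring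
    rw [this, h1]; noncomm_ring
  · have : (1 + y * v * x) * (1 - y * x) = 1 - y * x + y * (v * (1 - x * y)) * x := by noncomm_ring
    rw [this, h2]; noncomm_ring

lemma qnil_swap {A : Type*} [Ring A] (f b : A) (hs : Quasinilpotent (f * b)) :
    Quasinilpotent (b * f) := by
  intro x hx
  have hx2 : x * x * (b * f) = b * f * (x * x) := by
    rw [mul_assoc, hx, ← mul_assoc, hx, mul_assoc]
  have h1 : IsUnit (1 + f * b * (-(f * (x * x) * b))) := by
    apply hs
    have : f * (x * x * (b * f)) * b = f * (b * f * (x * x)) * b := by rw [hx2]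
    simp only [mul_neg, neg_mul, neg_inj]
    simpa only [mul_assoc] using this
  have h2 : IsUnit (1 - (f * b * f * (x * x)) * b) := by
    convert h1 using 1; noncomm_ring
  have h3 := isUnit_swap_aux h2
  have h4 : 1 - b * (f * b * f * (x * x)) = (1 + b * f * x) * (1 - b * f * x) := by
    have e : b * f * x * (b * f * x) = b * f * (b * f) * (x * x) := by
      calc b * f * x * (b * f * x) = b * f * (x * (b * f)) * x := by noncomm_ring
        _ = _ := by rw [hx]; noncomm_ring
    calc 1 - b * (f * b * f * (x * x)) = 1 - b * f * (b * f) * (x * x) := by noncomm_ring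
      _ = 1 - b * f * x * (b * f * x) := by rw [e]
      _ = _ := by noncomm_ring
  rw [h4] at h3
  have hc : Commute (1 + b * f * x) (1 - b * f * x) := by
    show _ * _ = _ * _
    noncomm_ring
  exact (hc.isUnit_mul_iff.mp h3).1

lemma cline_aux {A : Type*} [Ring A] (b d y : A) (hy : IsGenHiranoInv (d * b) y) :
    IsGenHiranoInv (b * d) (b * (y * y) * d) := by
  obtain ⟨h1, h2, h3⟩ := hy
  have h4 : d * b * (y * y) = y := by rw [← mul_assoc, h2, ← h1]
  have h5 : y * y * (d * b) = y := by rw [mul_assoc, ← h2, ← mul_assoc, ← h1]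
  have e1 : b * d * (b * (y * y) * d) = b * y * d := by
    calc _ = b * (d * b * (y * y)) * d := by noncomm_ring
      _ = _ := by rw [h4]
  have e2 : (b * (y * y) * d) * (b * d) = b * y * d := by
    calc _ = b * (y * y * (d * b)) * d := by noncomm_ring
      _ = _ := by rw [h5]
  refine ⟨?_, by rw [e1, e2], ?_⟩
  · rw [e2]
    calc b * (y * y) * d = b * (y * (d * b * (y * y))) * d := by rw [h4]
      _ = _ := by noncomm_ring
  · rw [e1]
    have : (b * d) ^ 2 - b * y * d = b * ((d * b - y) * d) := by noncomm_ring
    rw [this]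
    apply qnil_swap
    convert h3 using 1
    rw [h2]; noncomm_ring

open Filter Topology in
lemma vanish_aux {A : Type*} [NormedRing A] [NormedAlgebra ℂ A] [CompleteSpace A] (w : A)
    (hw : ∀ l : ℂ, IsUnit (1 + l • w)) (K C r : ℝ) (hK : 0 ≤ K) (hC : 0 ≤ C)
    (h : ∀ n : ℕ, r ≤ C * K ^ n * ‖w ^ n‖) : r ≤ 0 := by
  have hsr : spectralRadius ℂ w = 0 := by
    have : ∀ k ∈ spectrum ℂ w, k = 0 := by
      intro k hk
      by_contra hk0
      apply hk
      have := hw (-k⁻¹)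
      have h2 : algebraMap ℂ A k - w = k • (1 + (-k⁻¹) • w) := by
        rw [smul_add, smul_smul, Algebra.algebraMap_eq_smul_one]
        simp [hk0, sub_eq_add_neg]
      rw [spectrum.mem_resolventSet_iff, h2]
      have := this.smul (Units.mk0 k hk0)
      exact this
    simp only [spectralRadius, ENNReal.iSup_eq_zero]
    intro k hk
    simp [this k hk]
  have ht := spectrum.pow_norm_pow_one_div_tendsto_nhds_spectralRadius w
  rw [hsr] at ht
  have hpos : (0:ℝ) < 1 / (2 * (K + 1)) := by positivity
  have hev : ∀ᶠ n : ℕ in atTop, C * K ^ n * ‖w ^ n‖ ≤ C * (1/2 : ℝ) ^ n := by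
    have := ht.eventually (gt_mem_nhds (ENNReal.ofReal_pos.mpr hpos))
    filter_upwards [this, eventually_gt_atTop 0] with n hn hn0
    have h1 := (ENNReal.ofReal_lt_ofReal_iff hpos).mp hn
    have h2 : ‖w ^ n‖ ≤ (1 / (2 * (K + 1))) ^ n := by
      have h3 := pow_le_pow_left₀ (by positivity) h1.le n
      rwa [one_div, Real.rpow_inv_natCast_pow (norm_nonneg _) hn0.ne'] at h3
    rw [mul_assoc]
    refine mul_le_mul_of_nonneg_left ?_ hC
    calc K ^ n * ‖w ^ n‖ ≤ K ^ n * (1 / (2 * (K + 1))) ^ n := by gcongr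
      _ = (K * (1 / (2 * (K + 1)))) ^ n := by rw [mul_pow]
      _ ≤ (1/2) ^ n := by
        refine pow_le_pow_left₀ (by positivity) ?_ n
        rw [mul_one_div, div_le_div_iff₀ (by positivity) (by positivity)]
        linarith
  have hlim : Tendsto (fun n : ℕ => C * (1/2 : ℝ) ^ n) atTop (𝓝 (C * 0)) :=
    (tendsto_pow_atTop_nhds_zero_of_lt_one (by norm_num) (by norm_num)).const_mul C
  rw [mul_zero] at hlim
  exact ge_of_tendsto hlim (hev.mono fun n hn => (h n).trans hn)

lemma dcomm_aux {A : Type*} [NormedRing A] [NormedAlgebra ℂ A] [CompleteSpace A] (u v z : A)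
    (huv : u * v = v * u) (hv : v * u * v = v) (hq : Quasinilpotent (u - u * v))
    (hz : z * u = u * z) : v * z = z * v := by
  obtain ⟨p, hp⟩ : ∃ p, p = u * v := ⟨_, rfl⟩
  have hp' : p = v * u := hp.trans huv
  have hvp : v * p = v := by rw [hp, ← mul_assoc, hv]
  have hpv : p * v = v := by rw [hp', hv]
  have hpp : p * p = p := by
    calc p * p = u * (v * p) := by rw [← mul_assoc, ← hp]
      _ = p := by rw [hvp, hp]
  have hpu : p * u = u * p := by rw [hp, mul_assoc, ← huv]
  obtain ⟨w, hw⟩ : ∃ w, w = u * (1 - p) := ⟨_, rfl⟩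
  have hw' : w = (1 - p) * u := by rw [hw, mul_sub, sub_mul, hpu]; simp
  have hwq : ∀ l : ℂ, IsUnit (1 + l • w) := by
    intro l
    rw [← hp] at hq
    have := hq (l • (1 - p)) (by
      rw [smul_mul_assoc, mul_smul_comm]; congr 1
      simp only [mul_sub, sub_mul, one_mul, mul_one, hpu, hpp]; abel)
    convert this using 2
    rw [mul_smul_comm]; congr 1
    simp only [hw, mul_sub, sub_mul, one_mul, mul_one, hpp]; abel
  have key : ∀ t : A, (∀ n : ℕ, ‖t‖ ≤ ‖t‖ * ‖v‖ ^ n * ‖w ^ n‖) → t = 0 := fun t ht =>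
    norm_le_zero_iff.mp (vanish_aux w hwq _ _ _ (norm_nonneg _) (norm_nonneg _) ht)
  have bd : ∀ t : A, ∀ n : ℕ, ‖t * v ^ n‖ ≤ ‖t‖ * ‖v‖ ^ n ∧ ‖v ^ n * t‖ ≤ ‖t‖ * ‖v‖ ^ n := by
    intro t n
    induction n with
    | zero => simp
    | succ n ih =>
      constructor
      · rw [pow_succ, ← mul_assoc, pow_succ, ← mul_assoc]
        exact (norm_mul_le _ _).trans (mul_le_mul_of_nonneg_right ih.1 (norm_nonneg _))
      · rw [pow_succ' v, mul_assoc, show ‖t‖ * ‖v‖ ^ (n + 1) = ‖v‖ * (‖t‖ * ‖v‖ ^ n) by ring]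
        exact (norm_mul_le _ _).trans (mul_le_mul_of_nonneg_left ih.2 (norm_nonneg _))
  have pq : p * (1 - p) = 0 := by rw [mul_sub, hpp]; simp
  have qp : (1 - p) * p = 0 := by rw [sub_mul, hpp]; simp
  have qq : (1 - p) * (1 - p) = 1 - p := by rw [mul_sub, qp]; simp
  -- first corner
  have c1 : p * z * (1 - p) = 0 := by
    obtain ⟨t, ht⟩ : ∃ t, t = p * z * (1 - p) := ⟨_, rfl⟩
    rw [← ht]
    have e : v * t * w = t := by
      calc v * t * w = v * p * z * ((1 - p) * (1 - p)) * u := by rw [ht, hw']; noncomm_ring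
        _ = v * z * ((1 - p) * u) := by rw [hvp, qq, mul_assoc _ _ u]
        _ = v * (z * u) * (1 - p) := by rw [← hw', hw]; noncomm_ring
        _ = (v * u) * z * (1 - p) := by rw [hz]; noncomm_ring
        _ = t := by rw [← hp', ht]
    have en : ∀ n : ℕ, v ^ n * t * w ^ n = t := by
      intro n
      induction n with
      | zero => simp
      | succ n ih =>
        calc v ^ (n+1) * t * w ^ (n+1) = v ^ n * (v * t * w) * w ^ n := by
              rw [pow_succ, pow_succ']; simp only [mul_assoc]
          _ = t := by rw [e, ih]
    apply key
    intro n
    calc ‖t‖ = ‖v ^ n * t * w ^ n‖ := by rw [en]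
      _ ≤ ‖v ^ n * t‖ * ‖w ^ n‖ := norm_mul_le _ _
      _ ≤ _ := mul_le_mul_of_nonneg_right (bd t n).2 (norm_nonneg _)
  have c2 : (1 - p) * z * p = 0 := by
    obtain ⟨t, ht⟩ : ∃ t, t = (1 - p) * z * p := ⟨_, rfl⟩
    rw [← ht]
    have e : w * t * v = t := by
      calc w * t * v = u * ((1 - p) * (1 - p)) * z * (p * v) := by rw [ht, hw]; noncomm_ring
        _ = (u * (1 - p)) * z * v := by rw [hpv, qq]
        _ = (1 - p) * (u * z) * v := by rw [← hw, hw']; noncomm_ring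
        _ = (1 - p) * z * (u * v) := by rw [← hz]; noncomm_ring
        _ = t := by rw [← hp, ht]
    have en : ∀ n : ℕ, w ^ n * (t * v ^ n) = t := by
      intro n
      induction n with
      | zero => simp
      | succ n ih =>
        calc w ^ (n+1) * (t * v ^ (n+1)) = w ^ n * ((w * t * v) * v ^ n) := by
              rw [pow_succ, pow_succ']; simp only [mul_assoc]
          _ = t := by rw [e, ih]
    apply key
    intro n
    calc ‖t‖ = ‖w ^ n * (t * v ^ n)‖ := by rw [en]
      _ ≤ ‖w ^ n‖ * ‖t * v ^ n‖ := norm_mul_le _ _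
      _ ≤ ‖w ^ n‖ * (‖t‖ * ‖v‖ ^ n) := mul_le_mul_of_nonneg_left (bd t n).1 (norm_nonneg _)
      _ = _ := mul_comm _ _
  have hpz : p * z = z * p := by
    have a1 : p * z = p * z * p := by
      rw [mul_sub, mul_one] at c1; exact sub_eq_zero.mp c1
    have a2 : z * p = p * z * p := by
      rw [sub_mul, one_mul, sub_mul] at c2; exact sub_eq_zero.mp c2
    rw [a1, ← a2]
  calc v * z = v * (p * z) := by rw [← mul_assoc, hvp]
    _ = v * (z * u) * v := by rw [hpz, hp]; simp only [mul_assoc]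
    _ = (v * u) * z * v := by rw [hz]; simp only [mul_assoc]
    _ = z * (p * v) := by rw [← hp', hpz, mul_assoc]
    _ = z * v := by rw [hpv]

lemma transfer_aux {A : Type*} [NormedRing A] [NormedAlgebra ℂ A] [CompleteSpace A] (s t x : A)
    (h : s * s = t * t) (hx : IsGenHiranoInv s x) : IsGenHiranoInv t (t * (x * x)) := by
  obtain ⟨h1, h2, h3⟩ := hx
  have a1 : s * (x * x) = x := by rw [← mul_assoc, h2, ← h1]
  have e1 : s * s * (x * x) = s * x := by rw [mul_assoc, a1]
  have a2 : x * x * s = x := by rw [mul_assoc, ← h2, ← mul_assoc, ← h1]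
  have e2 : x * x * (s * s) = s * x := by rw [← mul_assoc, a2, h2]
  have e3 : x * x * (s * x) = x * x := by rw [← mul_assoc, a2]
  have hc : x * x * t = t * (x * x) := by
    apply dcomm_aux (s * s)
    · rw [e1, e2]
    · rw [mul_assoc, e1, e3]
    · rw [e1, ← sq]; exact h3
    · rw [h, mul_assoc]
  have e4 : t * (t * (x * x)) = s * x := by rw [← mul_assoc, ← h, e1]
  refine ⟨?_, ?_, ?_⟩
  · rw [mul_assoc (t * (x * x)), e4, mul_assoc, e3]
  · rw [mul_assoc t (x * x) t, hc]
  · rw [e4, sq, ← h, ← sq]; exact h3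

theorem stmt13 {A : Type*} [NormedRing A] [NormedAlgebra ℂ A] [CompleteSpace A] (a b c d : A)
    (h : a * c * (a * c) = d * b * (d * b)) :
    (∃ x, IsGenHiranoInv (a * c) x) ↔ (∃ x, IsGenHiranoInv (b * d) x) := by
  constructor
  · rintro ⟨x, hx⟩
    exact ⟨_, cline_aux b d _ (transfer_aux _ _ x h hx)⟩
  · rintro ⟨x, hx⟩
    exact ⟨_, transfer_aux _ _ _ h.symm (cline_aux d b x hx)⟩
end

section
/- Let A be a complex Banach algebra with identity and let a, b ∈ A each have a generalized Hirano inverse. If a²b = aba and b²a = bab, then ab has a generalized Hirano inverse. -/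
open Filter Topology ENNReal in
theorem rad_mul_le {A : Type*} [NormedRing A] [NormedAlgebra ℂ A] [CompleteSpace A] (u v : A)
    (h : Commute u (u * v)) : spectralRadius ℂ (u * v) ≤ spectralRadius ℂ u * spectralRadius ℂ v := by
  have hp : ∀ n : ℕ, (u * v) ^ n = u ^ n * v ^ n := by
    intro n
    induction n with
    | zero => simp
    | succ n ih =>
      rw [pow_succ', ih, ← mul_assoc, ← (h.pow_left n).eq, pow_succ u, pow_succ' v]
      simp only [mul_assoc]
  have fin : ∀ w : A, spectralRadius ℂ w ≠ ⊤ := by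
    intro w
    have := spectrum.spectralRadius_le_pow_nnnorm_pow_one_div ℂ w 0
    refine ne_top_of_le_ne_top ?_ this
    simp [ENNReal.mul_eq_top]
  have hu := spectrum.pow_nnnorm_pow_one_div_tendsto_nhds_spectralRadius u
  have hv := spectrum.pow_nnnorm_pow_one_div_tendsto_nhds_spectralRadius v
  have huv := spectrum.pow_nnnorm_pow_one_div_tendsto_nhds_spectralRadius (u * v)
  refine le_of_tendsto_of_tendsto' huv (ENNReal.Tendsto.mul hu (Or.inr (fin v)) hv (Or.inr (fin u))) ?_
  intro n
  rw [← ENNReal.mul_rpow_of_nonneg _ _ (by positivity), hp n]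
  refine ENNReal.rpow_le_rpow ?_ (by positivity)
  exact_mod_cast nnnorm_mul_le _ _

theorem rad_zero_of {A : Type*} [NormedRing A] [NormedAlgebra ℂ A] (u : A)
    (h : ∀ k : ℂ, IsUnit (1 + k • u)) : spectralRadius ℂ u = 0 := by
  unfold spectralRadius
  simp only [ENNReal.iSup_eq_zero]
  intro k hk
  by_contra h0
  have hk0 : k ≠ 0 := by rintro rfl; simp at h0
  apply hk
  have h2 := (h (-k⁻¹)).smul (Units.mk0 k hk0)
  have : algebraMap ℂ A k - u = (Units.mk0 k hk0) • (1 + (-k⁻¹) • u) := by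
    rw [Units.smul_mk0, smul_add, smul_smul, Algebra.algebraMap_eq_smul_one]
    simp [hk0, sub_eq_add_neg]
  show IsUnit _
  rw [this]; exact h2

theorem unit_of_rad {A : Type*} [NormedRing A] [NormedAlgebra ℂ A] (u : A)
    (h : spectralRadius ℂ u = 0) : IsUnit (1 + u) := by
  have h1 : (-1 : ℂ) ∈ resolventSet ℂ u :=
    spectrum.mem_resolventSet_of_spectralRadius_lt (by rw [h]; simp)
  have h2 : IsUnit (algebraMap ℂ A (-1) - u) := h1
  have := h2.neg
  simpa [add_comm] using this

theorem rad_of_qnil {A : Type*} [NormedRing A] [NormedAlgebra ℂ A] (u : A)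
    (h : Quasinilpotent u) : spectralRadius ℂ u = 0 := by
  apply rad_zero_of
  intro k
  have := h (k • 1) (by simp)
  simpa using this

theorem qnil_of_rad {A : Type*} [NormedRing A] [NormedAlgebra ℂ A] [CompleteSpace A] (u : A)
    (h : spectralRadius ℂ u = 0) : Quasinilpotent u := by
  intro x hx
  apply unit_of_rad
  have hc : Commute u x := hx.symm
  have := rad_mul_le u x ((Commute.refl u).mul_right hc)
  simpa [h] using this

theorem rad_add {A : Type*} [NormedRing A] [NormedAlgebra ℂ A] [CompleteSpace A] (s t : A)
    (hs : spectralRadius ℂ s = 0) (ht : spectralRadius ℂ t = 0) (hc : Commute s t) :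
    spectralRadius ℂ (s + t) = 0 := by
  apply rad_zero_of
  intro k
  have h1 : IsUnit (1 + k • s) := by
    have := qnil_of_rad s hs (k • 1) (by simp)
    simpa using this
  obtain ⟨g, hg⟩ := h1
  have hgt : Commute (g : A) t := by
    rw [hg]; exact (Commute.one_left t).add_left (hc.smul_left k)
  have hgi : Commute (↑g⁻¹ : A) t := hgt.units_inv_left
  have h2 := qnil_of_rad t ht (k • (↑g⁻¹ : A)) (hgi.smul_left k).eq
  have h3 : 1 + k • (s + t) = (1 + t * (k • (↑g⁻¹ : A))) * g := by
    rw [add_mul, mul_assoc, smul_mul_assoc, Units.inv_mul, hg, smul_add]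
    simp [add_assoc]
  rw [h3]
  exact h2.mul g.isUnit

theorem sylv {A : Type*} [NormedRing A] [NormedAlgebra ℂ A] [CompleteSpace A] (N c w : A)
    (hN : spectralRadius ℂ N = 0) :
    (w = c * w * N → w = 0) ∧ (w = N * w * c → w = 0) := by
  let L : A → (A →L[ℂ] A) := fun z => ContinuousLinearMap.mul ℂ A z
  let R : A → (A →L[ℂ] A) := fun z => (ContinuousLinearMap.mul ℂ A).flip z
  have hu : ∀ k : ℂ, IsUnit (1 + k • N) := by
    intro k
    have := qnil_of_rad N hN (k • 1) (by simp)
    simpa using this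
  have hL : spectralRadius ℂ (L N) = 0 := by
    apply rad_zero_of
    intro k
    obtain ⟨g, hg⟩ := hu k
    have e : 1 + k • L N = L g := by
      ext z; simp [L, hg, add_mul]
    rw [e]
    exact ⟨⟨L g, L ↑g⁻¹, by ext z; simp [L], by ext z; simp [L]⟩, rfl⟩
  have hR : spectralRadius ℂ (R N) = 0 := by
    apply rad_zero_of
    intro k
    obtain ⟨g, hg⟩ := hu k
    have e : 1 + k • R N = R g := by
      ext z; simp [R, hg, mul_add]
    rw [e]
    exact ⟨⟨R g, R ↑g⁻¹, by ext z; simp [R], by ext z; simp [R]⟩, rfl⟩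
  have key : ∀ T : A →L[ℂ] A, IsUnit (1 + T) → w + T w = 0 → w = 0 := by
    rintro T ⟨g, hg⟩ h
    have h1 : (g : A →L[ℂ] A) w = 0 := by rw [hg]; simpa using h
    have h2 : ((↑g⁻¹ * ↑g : A →L[ℂ] A)) w = 0 := by
      rw [mul_apply_eq_comp, h1, map_zero]
    simpa using h2
  constructor
  · intro h
    apply key _ (qnil_of_rad _ hR (-(L c)) (by ext z; simp [L, R, mul_assoc]))
    simp only [L, R, mul_apply_eq_comp, neg_apply,
      ContinuousLinearMap.flip_apply, ContinuousLinearMap.mul_apply']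
    rw [neg_mul, ← h, add_neg_cancel]
  · intro h
    apply key _ (qnil_of_rad _ hL (-(R c)) (by ext z; simp [L, R, mul_assoc]))
    simp only [L, R, mul_apply_eq_comp, neg_apply,
      ContinuousLinearMap.flip_apply, ContinuousLinearMap.mul_apply']
    rw [mul_neg, ← mul_assoc, ← h, add_neg_cancel]

theorem dcomm {A : Type*} [NormedRing A] [NormedAlgebra ℂ A] [CompleteSpace A] (a x z : A)
    (hx : IsGenHiranoInv a x) (hz : Commute a z) : Commute x z := by
  obtain ⟨h1, h2, h3⟩ := hx
  have hz' : a * z = z * a := hz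
  have hr := rad_of_qnil _ h3
  set p := a * x with hp
  have hpx : p * x = x := by rw [h2]; exact h1.symm
  have hxp : x * p = x := by rw [hp, ← mul_assoc]; exact h1.symm
  have hpp : p * p = p := by
    conv_lhs => rw [hp, mul_assoc, ← hp, hxp]
  have hpa : p * a = a * p := by rw [hp, mul_assoc, ← h2]
  have hN : spectralRadius ℂ ((a ^ 2 - p) * (1 - p)) = 0 := by
    have hc : Commute (a ^ 2 - p) (1 - p) := by
      apply Commute.sub_right (Commute.one_right _)
      apply Commute.sub_left _ (Commute.refl p)
      exact Commute.pow_left hpa.symm 2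
    have := rad_mul_le _ _ ((Commute.refl (a ^ 2 - p)).mul_right hc)
    simpa [hr] using this
  have hNe : (a ^ 2 - p) * (1 - p) = a ^ 2 * (1 - p) := by
    rw [sub_mul, mul_sub p, hpp]; simp
  rw [hNe] at hN
  have hcq : a * (1 - p) = (1 - p) * a := by rw [mul_sub, sub_mul, hpa]; simp
  have hqq : (1 - p) * (1 - p) = 1 - p := by rw [mul_sub, sub_mul (1 : A) p p, hpp]; simp
  have hxxaa : x * x * a * a = p := by
    rw [mul_assoc x x a, ← h2, hxp, ← h2]
  have haaxx : a * a * x * x = p := by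
    rw [mul_assoc a a x, ← hp, mul_assoc, hpx]
  have e1 : p * z * (1 - p) = 0 := by
    apply (sylv _ (x * x) _ hN).1
    generalize 1 - p = q at hcq hqq
    symm
    calc x * x * (p * z * q) * (a ^ 2 * q) = x * (x * p) * z * (q * a) * a * q := by
          simp only [pow_two, mul_assoc]
      _ = x * x * (z * a) * (q * a) * q := by
          conv_lhs => rw [hxp, ← hcq]
          simp only [mul_assoc]
      _ = x * x * (a * z) * a * (q * q) := by
          conv_lhs => rw [← hz', ← hcq]
          simp only [mul_assoc]
      _ = x * x * a * (z * a) * q := by rw [hqq]; simp only [mul_assoc]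
      _ = (x * x * a * a) * z * q := by rw [← hz']; simp only [mul_assoc]
      _ = p * z * q := by rw [hxxaa]
  have e2 : (1 - p) * z * p = 0 := by
    apply (sylv _ (x * x) _ hN).2
    generalize 1 - p = q at hcq hqq
    symm
    calc a ^ 2 * q * (q * z * p) * (x * x) = a * a * (q * q) * z * (p * x * x) := by
          simp only [pow_two, mul_assoc]
      _ = a * (a * q) * z * (x * x) := by rw [hqq, hpx]; simp only [mul_assoc]
      _ = (a * q) * (a * z) * (x * x) := by
          conv_lhs => rw [hcq]
          simp only [mul_assoc]
      _ = q * (a * z) * a * (x * x) := by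
          conv_lhs => rw [hcq, hz']
          simp only [mul_assoc]
      _ = q * z * (a * a * x * x) := by rw [hz']; simp only [mul_assoc]
      _ = q * z * p := by rw [haaxx]
  have hpz : p * z = z * p := by
    rw [mul_sub, mul_one, sub_eq_zero] at e1
    rw [sub_mul, sub_mul, one_mul, sub_eq_zero] at e2
    rw [e1, e2]
  show x * z = z * x
  calc x * z = x * (p * z) := by rw [← mul_assoc, hxp]
    _ = x * (z * a) * x := by rw [hpz, hp]; simp only [mul_assoc]
    _ = (x * a) * z * x := by rw [← hz']; simp only [mul_assoc]
    _ = z * (p * x) := by rw [← h2, hpz, mul_assoc]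
    _ = z * x := by rw [hpx]

theorem stmt14 {A : Type*} [NormedRing A] [NormedAlgebra ℂ A] [CompleteSpace A] (a b : A)
    (ha : ∃ x, IsGenHiranoInv a x) (hb : ∃ x, IsGenHiranoInv b x)
    (h1 : a ^ 2 * b = a * b * a) (h2 : b ^ 2 * a = b * a * b) :
    ∃ x, IsGenHiranoInv (a * b) x := by
  obtain ⟨x, hx⟩ := ha
  obtain ⟨y, hy⟩ := hb
  have dx := fun z => dcomm a x z hx
  have dy := fun z => dcomm b y z hy
  obtain ⟨x1, x2, x3⟩ := hx
  obtain ⟨y1, y2, y3⟩ := hy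
  have rx := rad_of_qnil _ x3
  have ry := rad_of_qnil _ y3
  have cax : Commute a x := x2
  have cby : Commute b y := y2
  have a_ab : Commute a (a * b) := by
    show a * (a * b) = a * b * a
    rw [← h1, pow_two, mul_assoc]
  have b_ba : Commute b (b * a) := by
    show b * (b * a) = b * a * b
    rw [← h2, pow_two, mul_assoc]
  have x_ab := dx _ a_ab
  have y_ba := dy _ b_ba
  have hxe : x = a * x * x := by rw [x2]; exact x1
  have hye : y = b * y * y := by rw [y2]; exact y1
  have hxe' : x = x * x * a := by rw [mul_assoc, ← x2, ← mul_assoc]; exact x1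
  have a_ay : Commute a (a * y) := by
    have k : a * b * (y * y) = a * (y * y) * b := by
      rw [mul_assoc, mul_assoc, ((cby.mul_right cby).eq)]
    have k1 : b * a * y = b * y * a := by rw [← y_ba.eq, ← mul_assoc, ← y2]
    have k2 : b * a * y * y = b * y * y * a := by
      rw [k1, mul_assoc (b * y), y2, mul_assoc y b, ← mul_assoc b, k1, ← mul_assoc, ← mul_assoc]
    have k3 : a * y = a * b * y * y := by
      conv_lhs => rw [hye]
      simp only [mul_assoc]
    show a * (a * y) = a * y * a
    calc a * (a * y) = a * (a * b) * y * y := by rw [k3]; simp only [mul_assoc]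
      _ = a * (b * a * y * y) := by rw [a_ab.eq]; simp only [mul_assoc]
      _ = a * (b * y * y) * a := by rw [k2]; simp only [mul_assoc]
      _ = a * y * a := by rw [← hye]
  have x_ay := dx _ a_ay
  have b_bx : b * x * b = b * b * x := by
    have k1 : a * b * x = a * x * b := by rw [← x_ab.eq, ← mul_assoc, ← x2]
    have k2 : a * b * x * x = a * x * x * b := by
      rw [k1, mul_assoc (a * x), x2, mul_assoc x a, ← mul_assoc a, k1, ← mul_assoc, ← mul_assoc]
    have k3 : b * x = b * a * x * x := by
      conv_lhs => rw [hxe]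
      simp only [mul_assoc]
    symm
    calc b * b * x = b * (b * a) * x * x := by rw [mul_assoc, k3]; simp only [mul_assoc]
      _ = b * (a * b * x * x) := by rw [b_ba.eq]; simp only [mul_assoc]
      _ = b * (a * x * x) * b := by rw [k2]; simp only [mul_assoc]
      _ = b * x * b := by rw [← hxe]
  have b_bx' : Commute b (b * x) := by
    show b * (b * x) = b * x * b
    rw [b_bx, mul_assoc]
  have y_bx := dy _ b_bx'
  have byx : b * y * x = b * x * y := by rw [← y_bx.eq, ← mul_assoc, ← y2]
  have bya : b * y * a = b * a * y := by rw [← y_ba.eq, ← mul_assoc, ← y2]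
  have a_abb : Commute a (a * (b * b)) := by
    show a * (a * (b * b)) = a * (b * b) * a
    calc a * (a * (b * b)) = a * (a * b) * b := by simp only [mul_assoc]
      _ = a * (b * a * b) := by rw [a_ab.eq]; simp only [mul_assoc]
      _ = a * (b * b) * a := by rw [← b_ba.eq]; simp only [mul_assoc]
  have a_aby : Commute a (a * (b * y)) := by
    show a * (a * (b * y)) = a * (b * y) * a
    calc a * (a * (b * y)) = a * (a * b) * y := by simp only [mul_assoc]
      _ = a * (b * a * y) := by rw [a_ab.eq]; simp only [mul_assoc]
      _ = a * (b * y) * a := by rw [← bya]; simp only [mul_assoc]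
  have a_an : Commute a (a * (b ^ 2 - b * y)) := by
    rw [mul_sub, pow_two]; exact a_abb.sub_right a_aby
  rw [← pow_two] at a_abb
  have x_an := dx _ a_an
  have x_abb := dx _ a_abb
  set n1 := a ^ 2 - a * x with hn1
  set n2 := b ^ 2 - b * y with hn2
  have n1e : n1 = (a - x) * a := by rw [hn1, sub_mul, pow_two, x2]
  have n1c : ∀ z, Commute a z → Commute x z → Commute n1 z := fun z h h' =>
    (h.pow_left 2).sub_left (h.mul_left h')
  have ca1 : Commute n1 a := n1c a (Commute.refl a) cax.symm
  have cx1 : Commute n1 x := n1c x cax (Commute.refl x)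
  have n2b : n2 * b ^ 2 = b ^ 2 * n2 := by
    have : Commute n2 b := ((Commute.refl b).pow_left 2).sub_left ((Commute.refl b).mul_left cby.symm)
    exact (this.pow_right 2).eq
  have rs : spectralRadius ℂ (n1 * b ^ 2) = 0 := by
    have hc : Commute n1 (n1 * b ^ 2) := by
      have e : n1 * b ^ 2 = (a - x) * (a * b ^ 2) := by rw [n1e, mul_assoc]
      have h := (ca1.sub_right cx1).mul_right (n1c _ a_abb x_abb)
      rw [e]; exact h
    have := rad_mul_le _ _ hc
    simpa [rx] using this
  have rt : spectralRadius ℂ (a * x * n2) = 0 := by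
    have hc : Commute (a * x) (a * x * n2) := by
      have e : a * x * n2 = x * (a * n2) := by rw [x2, mul_assoc]
      rw [e]
      exact (cax.mul_left (Commute.refl x)).mul_right (a_an.mul_left x_an)
    have := rad_mul_le _ _ hc
    simpa [ry] using this
  have cst : Commute (n1 * b ^ 2) (a * x * n2) := by
    show n1 * b ^ 2 * (a * x * n2) = a * x * n2 * (n1 * b ^ 2)
    have hpc : Commute (a * x) (a * b ^ 2) := a_abb.mul_left x_abb
    have hn : Commute n1 (a * n2) := n1c _ a_an x_an
    have hpa : Commute (a * x) a := (Commute.refl a).mul_left cax.symm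
    calc n1 * b ^ 2 * (a * x * n2) = (a - x) * ((a * b ^ 2) * (a * x)) * n2 := by
          rw [n1e]; simp only [mul_assoc]
      _ = (a - x) * ((a * x) * a) * b ^ 2 * n2 := by rw [← hpc.eq]; simp only [mul_assoc]
      _ = n1 * (x * a) * (b ^ 2 * n2) := by rw [hpa.eq, n1e, x2]; simp only [mul_assoc]
      _ = x * (n1 * (a * n2)) * b ^ 2 := by
          rw [← n2b, ← mul_assoc n1 x, cx1.eq]; simp only [mul_assoc]
      _ = _ := by rw [hn.eq, x2]; simp only [mul_assoc]
  have cw : a * b * (x * y) = a * x * (b * y) := by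
    rw [← mul_assoc, ← x_ab.eq, ← mul_assoc, ← x2]; simp only [mul_assoc]
  have wc : x * y * (a * b) = a * x * (b * y) := by
    calc x * y * (a * b) = x * x * (a * y * a) * b := by
          conv_lhs => rw [hxe']
          simp only [mul_assoc]
      _ = (x * x * a) * a * (y * b) := by rw [← a_ay.eq]; simp only [mul_assoc]
      _ = _ := by rw [← hxe', x2, y2]
  refine ⟨x * y, ?_, ?_, ?_⟩
  · rw [wc]
    symm
    calc a * x * (b * y) * (x * y) = a * x * (b * y * x) * y := by simp only [mul_assoc]
      _ = x * ((a * b) * x) * y * y := by rw [byx, x2]; simp only [mul_assoc]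
      _ = (x * x * a) * (b * y * y) := by rw [← x_ab.eq]; simp only [mul_assoc]
      _ = x * y := by rw [← hxe', ← hye]
  · rw [cw, wc]
  · apply qnil_of_rad
    have : (a * b) ^ 2 - a * b * (x * y) = n1 * b ^ 2 + a * x * n2 := by
      have e : (a * b) ^ 2 = a ^ 2 * b ^ 2 := by
        rw [pow_two, ← mul_assoc, ← a_ab.eq]; simp only [pow_two, mul_assoc]
      rw [cw, e, hn1, hn2, sub_mul, mul_sub]; abel
    rw [this]
    exact rad_add _ _ rs rt cst
end
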